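/- arXiv:0906.2915 — 2 statements merged into one kernel-verified Lean document; each statement's English description precedes it below -/
import Mathlib

section
/- Let 𝔛 be a Banach space and let 𝖠 ⊆ B(𝔛) be precompact and nonempty. Then ρ̂(𝖠) = max{ρ_χ(𝖠), ρ_r(𝖠)} (the generalized Berger–Wang formula). -/
open Filter Topology MeasureTheory

noncomputable section

variable {𝕏 : Type*} [NormedAddCommGroup 𝕏] [NormedSpace ℝ 𝕏] [CompleteSpace 𝕏]

/-- The spectral radius `ρ(A) = lim_k ‖A^k‖^{1/k}` (Gelfand limit). -/
def specRad {R : Type*} [NormedRing R] (A : R) : ℝ :=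
  Filter.atTop.limsup fun k : ℕ => ‖A ^ k‖ ^ (1 / (k : ℝ))

/-- The set `𝖠ⁿ` of all products of `n` elements of `A`. -/
def prods {R : Type*} [NormedRing R] (A : Set R) (n : ℕ) : Set R :=
  {P | ∃ f : Fin n → R, (∀ i, f i ∈ A) ∧ P = (List.ofFn f).prod}

/-- The Hausdorff measure of noncompactness `‖L‖_χ` of a bounded operator: the infimum of all
`ε > 0` such that the image of the unit ball under `L` admits a finite `ε`-net. -/
def hmnc (L : 𝕏 →L[ℝ] 𝕏) : ℝ :=
  sInf {ε : ℝ | 0 < ε ∧ ∃ S : Finset 𝕏,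
    L '' Metric.closedBall 0 1 ⊆ ⋃ y ∈ S, Metric.ball y ε}

/-- `‖L‖_f`: the distance from `L` to the finite-rank operators. -/
def fdist (L : 𝕏 →L[ℝ] 𝕏) : ℝ :=
  sInf {c : ℝ | ∃ K : 𝕏 →L[ℝ] 𝕏,
    FiniteDimensional ℝ (LinearMap.range (K : 𝕏 →ₗ[ℝ] 𝕏)) ∧ c = ‖L - K‖}

section Words

variable {M : Type*} [Monoid M]

/-- The product `a j * a (j + 1) * ⋯ * a (j + n - 1)`. -/
def wordProd (a : ℕ → M) (j : ℕ) : ℕ → M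
  | 0 => 1
  | n + 1 => wordProd a j n * a (j + n)

theorem wordProd_zero (a : ℕ → M) (j : ℕ) : wordProd a j 0 = 1 := rfl

theorem wordProd_succ (a : ℕ → M) (j n : ℕ) :
    wordProd a j (n + 1) = wordProd a j n * a (j + n) := rfl

theorem wordProd_one (a : ℕ → M) (j : ℕ) : wordProd a j 1 = a j := one_mul _

theorem wordProd_add (a : ℕ → M) (j m n : ℕ) :
    wordProd a j (m + n) = wordProd a j m * wordProd a (j + m) n := by
  induction n with
  | zero => simp [wordProd_zero]
  | succ n ih => rw [← add_assoc, wordProd_succ, ih, wordProd_succ, mul_assoc, add_assoc]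

theorem wordProd_succ' (a : ℕ → M) (j n : ℕ) :
    wordProd a j (n + 1) = a j * wordProd a (j + 1) n := by
  rw [add_comm n 1, wordProd_add, wordProd_one]

theorem wordProd_wordProd (a : ℕ → M) (k n : ℕ) :
    wordProd (fun i => wordProd a (k * i) k) 0 n = wordProd a 0 (k * n) := by
  induction n with
  | zero => rfl
  | succ n ih => rw [wordProd_succ, ih, Nat.mul_succ, wordProd_add, zero_add, zero_add]

end Words

section Recurrence

open Classical in
/-- Pliss lemma: a sequence with bounded increments has many times which minimize the rest
of the sequence. -/
theorem sub_le_mul_card_pliss (a : ℕ → ℝ) {D : ℝ} (hD : 0 ≤ D) (K : ℕ)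
    (ha : ∀ i < K, a (i + 1) ≤ a i + D) (i : ℕ) (hi : i ≤ K) :
    a K - a i ≤ D * ({t ∈ Finset.Ico i K | ∀ s, t < s → s ≤ K → a t ≤ a s} : Finset ℕ).card := by
  induction hd : K - i using Nat.strong_induction_on generalizing i with
  | _ d ih =>
    rcases hi.eq_or_lt with rfl | hlt
    · simp
    by_cases hp : ∀ s, i < s → s ≤ K → a i ≤ a s
    · have h1 := ih (K - (i + 1)) (by omega) (i + 1) hlt rfl
      rw [← Finset.insert_Ico_add_one_left_eq_Ico hlt, Finset.filter_insert, if_pos hp,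
        Finset.card_insert_of_notMem (by simp)]
      push_cast
      linarith [ha i hlt]
    · push Not at hp
      obtain ⟨s, his, hsK, hs⟩ := hp
      have h1 := ih (K - s) (by omega) s hsK rfl
      have h2 : ({t ∈ Finset.Ico s K | ∀ s, t < s → s ≤ K → a t ≤ a s} : Finset ℕ).card ≤
          ({t ∈ Finset.Ico i K | ∀ s, t < s → s ≤ K → a t ≤ a s} : Finset ℕ).card :=
        Finset.card_le_card (Finset.filter_subset_filter _ (Finset.Ico_subset_Ico_left his.le))
      have h3 : (({t ∈ Finset.Ico s K | ∀ s, t < s → s ≤ K → a t ≤ a s} : Finset ℕ).card : ℝ) ≤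
          ({t ∈ Finset.Ico i K | ∀ s, t < s → s ≤ K → a t ≤ a s} : Finset ℕ).card :=
        Nat.cast_le.2 h2
      nlinarith [mul_le_mul_of_nonneg_left h3 hD]

/-- Two long sequences with nearly extremal growth have a common pair of good times with
the same colour. -/
theorem exists_good_pair (a a' : ℕ → ℝ) {L : ℝ} (hL : 0 < L) (K q : ℕ) (hK : 2 * q + 8 ≤ K)
    (ha : ∀ i < K, a (i + 1) ≤ a i + 8 * L) (ha' : ∀ i < K, a' (i + 1) ≤ a' i + 8 * L)
    (haK : (7 * K - 1) * L ≤ a K - a 0) (haK' : (7 * K - 1) * L ≤ a' K - a' 0)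
    (col : ℕ → Fin q) :
    ∃ j l, j < l ∧ l < K ∧ col j = col l ∧
      (∀ s, j < s → s ≤ K → a j ≤ a s) ∧ (∀ s, l < s → s ≤ K → a l ≤ a s) ∧
      (∀ s, K - (j + 1) < s → s ≤ K → a' (K - (j + 1)) ≤ a' s) ∧
      (∀ s, K - l < s → s ≤ K → a' (K - l) ≤ a' s) := by
  classical
  set P : (ℕ → ℝ) → Finset ℕ :=
    fun a => {t ∈ Finset.Ico 0 K | ∀ s, t < s → s ≤ K → a t ≤ a s}
  have hmem : ∀ (a : ℕ → ℝ) {t}, t < K → t ∉ Finset.range K \ P a →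
      ∀ s, t < s → s ≤ K → a t ≤ a s := by
    intro a t ht hn
    by_contra hcon
    refine hn (Finset.mem_sdiff.2 ⟨Finset.mem_range.2 ht, fun h => hcon ?_⟩)
    exact (Finset.mem_filter.1 h).2
  have hcard : ∀ a : ℕ → ℝ, (∀ i < K, a (i + 1) ≤ a i + 8 * L) → (7 * K - 1) * L ≤ a K - a 0 →
      8 * (Finset.range K \ P a).card ≤ K + 1 := by
    intro a ha haK
    have h1 := sub_le_mul_card_pliss a (by positivity : 0 ≤ 8 * L) K ha 0 (Nat.zero_le _)
    have h2 : (7 * K - 1 : ℝ) ≤ 8 * (P a).card := by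
      have : (7 * K - 1) * L ≤ (8 * (P a).card) * L := haK.trans (h1.trans_eq (by ring))
      exact le_of_mul_le_mul_right this hL
    have h3 : 7 * K ≤ 8 * (P a).card + 1 := by
      have : (7 * K : ℝ) ≤ 8 * (P a).card + 1 := by linarith
      exact_mod_cast this
    have h4 : P a ⊆ Finset.range K := by
      rw [Finset.range_eq_Ico]
      exact Finset.filter_subset _ _
    rw [Finset.card_sdiff_of_subset h4, Finset.card_range]
    omega
  set B1 := Finset.range K \ P a
  set B2 := (Finset.range K \ P a').image fun t => K - t
  set B3 := (Finset.range K \ P a').image fun t => K - 1 - t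
  have c1 : 8 * B1.card ≤ K + 1 := hcard a ha haK
  have c2 := hcard a' ha' haK'
  have c3 : B2.card ≤ (Finset.range K \ P a').card := Finset.card_image_le
  have c4 : B3.card ≤ (Finset.range K \ P a').card := Finset.card_image_le
  set G := Finset.Ico 1 K \ (B1 ∪ B2 ∪ B3)
  have hG : q < G.card := by
    have h1 := Finset.le_card_sdiff (B1 ∪ B2 ∪ B3) (Finset.Ico 1 K)
    have h2 := Finset.card_union_le (B1 ∪ B2) B3
    have h3 := Finset.card_union_le B1 B2
    rw [Nat.card_Ico] at h1
    change _ ≤ G.card at h1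
    omega
  have hgood : ∀ i ∈ G, i < K ∧ (∀ s, i < s → s ≤ K → a i ≤ a s) ∧
      (∀ s, K - (i + 1) < s → s ≤ K → a' (K - (i + 1)) ≤ a' s) ∧
      (∀ s, K - i < s → s ≤ K → a' (K - i) ≤ a' s) := by
    intro i hi
    simp only [G, Finset.mem_sdiff, Finset.mem_union, Finset.mem_Ico, not_or] at hi
    obtain ⟨⟨h1, hiK⟩, ⟨n1, n2⟩, n3⟩ := hi
    refine ⟨hiK, hmem a hiK n1, hmem a' (by omega) fun h => n3 ?_,
      hmem a' (by omega) fun h => n2 ?_⟩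
    · exact Finset.mem_image.2 ⟨_, h, by omega⟩
    · exact Finset.mem_image.2 ⟨_, h, by omega⟩
  obtain ⟨j, hj, l, hl, hne, hc⟩ := Finset.exists_ne_map_eq_of_card_lt_of_maps_to
    (t := (Finset.univ : Finset (Fin q))) (f := col) (by simpa using hG) (fun _ _ => by simp)
  rcases lt_or_gt_of_ne hne with h | h
  · exact ⟨j, l, h, (hgood l hl).1, hc, (hgood j hj).2.1, (hgood l hl).2.1, (hgood j hj).2.2.1,
      (hgood l hl).2.2.2⟩
  · exact ⟨l, j, h, (hgood j hj).1, hc.symm, (hgood l hl).2.1, (hgood j hj).2.1,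
      (hgood l hl).2.2.1, (hgood j hj).2.2.2⟩

end Recurrence

section ExteriorAction

variable {E : Type*} [NormedAddCommGroup E] [NormedSpace ℝ E]

/-- The pullback action of a bounded operator on continuous alternating `n`-forms. -/
def altPullback (n : ℕ) (L : E →L[ℝ] E) : (E [⋀^Fin n]→L[ℝ] ℝ) →L[ℝ] (E [⋀^Fin n]→L[ℝ] ℝ) :=
  ContinuousAlternatingMap.compContinuousLinearMapCLM L

/-- The growth of `n`-dimensional volumes under a bounded operator. -/
def altNorm (n : ℕ) (L : E →L[ℝ] E) : ℝ := ‖altPullback n L‖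

theorem altPullback_one (n : ℕ) : altPullback n (1 : E →L[ℝ] E) = 1 := rfl

theorem altPullback_mul (n : ℕ) (L M : E →L[ℝ] E) :
    altPullback n (L * M) = altPullback n M * altPullback n L := rfl

theorem continuous_altPullback (n : ℕ) :
    Continuous (altPullback n : (E →L[ℝ] E) → _) :=
  ContinuousAlternatingMap.continuous_compContinuousLinearMapCLM

theorem altNorm_nonneg (n : ℕ) (L : E →L[ℝ] E) : 0 ≤ altNorm n L :=
  norm_nonneg (altPullback n L)

theorem altNorm_one_le (n : ℕ) : altNorm n (1 : E →L[ℝ] E) ≤ 1 := by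
  rw [altNorm, altPullback_one]
  exact ContinuousLinearMap.norm_id_le

theorem altNorm_mul_le (n : ℕ) (L M : E →L[ℝ] E) :
    altNorm n (L * M) ≤ altNorm n L * altNorm n M := by
  rw [altNorm, altPullback_mul, mul_comm]
  exact norm_mul_le (altPullback n M) (altPullback n L)

/-- A continuous alternating form bounded on tuples in the unit ball is bounded in norm. -/
theorem ContinuousAlternatingMap.norm_le_of_unit_ball {n : ℕ} (ω : E [⋀^Fin n]→L[ℝ] ℝ) {C : ℝ}
    (hC : 0 ≤ C) (h : ∀ z : Fin n → E, (∀ i, ‖z i‖ ≤ 1) → |ω z| ≤ C) : ‖ω‖ ≤ C := by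
  refine ω.opNorm_le_bound hC fun z => ?_
  by_cases hz : ∃ i, z i = 0
  · obtain ⟨i, hi⟩ := hz
    rw [ω.map_coord_zero i hi, norm_zero]
    positivity
  · push Not at hz
    have hz' : z = fun i => ‖z i‖ • (‖z i‖⁻¹ • z i) := by
      funext i
      rw [smul_smul, mul_inv_cancel₀ (norm_ne_zero_iff.2 (hz i)), one_smul]
    have h1 := h (fun i => ‖z i‖⁻¹ • z i) fun i => by
      rw [norm_smul, norm_inv, norm_norm, inv_mul_cancel₀ (norm_ne_zero_iff.2 (hz i))]
    have h2 : ω z = (∏ i, ‖z i‖) • ω (fun i => ‖z i‖⁻¹ • z i) := by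
      conv_lhs => rw [hz']
      exact ω.map_smul_univ _ _
    rw [h2, norm_smul, Real.norm_eq_abs, Real.norm_eq_abs, abs_of_nonneg (by positivity), mul_comm]
    gcongr

theorem altNorm_le_of_unit_ball {n : ℕ} (L : E →L[ℝ] E) {C : ℝ} (hC : 0 ≤ C)
    (h : ∀ ω : E [⋀^Fin n]→L[ℝ] ℝ, ‖ω‖ ≤ 1 → ∀ z : Fin n → E, (∀ i, ‖z i‖ ≤ 1) →
      |ω (fun i => L (z i))| ≤ C) : altNorm n L ≤ C := by
  refine ContinuousLinearMap.opNorm_le_of_unit_norm hC fun ω hω => ?_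
  exact ContinuousAlternatingMap.norm_le_of_unit_ball _ hC fun z hz => h ω hω.le z hz

theorem altNorm_le_pow (n : ℕ) (L : E →L[ℝ] E) : altNorm n L ≤ ‖L‖ ^ n := by
  refine altNorm_le_of_unit_ball L (by positivity) fun ω hω z hz => ?_
  calc |ω (fun i => L (z i))| ≤ ‖ω‖ * ∏ _i : Fin n, ‖L‖ :=
        ω.le_opNorm_mul_prod_of_le fun i => L.unit_le_opNorm _ (hz i)
    _ ≤ ‖L‖ ^ n := by
      rw [Finset.prod_const, Finset.card_univ, Fintype.card_fin]
      exact mul_le_of_le_one_left (by positivity) hω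

theorem norm_altPullback_sub_le (n : ℕ) (L M : E →L[ℝ] E) {R : ℝ} (hL : ‖L‖ ≤ R) (hM : ‖M‖ ≤ R) :
    ‖altPullback n L - altPullback n M‖ ≤ n * R ^ (n - 1) * ‖L - M‖ := by
  have hR : 0 ≤ R := (norm_nonneg L).trans hL
  refine ContinuousLinearMap.opNorm_le_of_unit_norm (by positivity) fun ω hω => ?_
  refine ContinuousAlternatingMap.norm_le_of_unit_ball _ (by positivity) fun z hz => ?_
  have h := ω.norm_image_sub_le (fun i => L (z i)) (fun i => M (z i))
  rw [hω, one_mul, Fintype.card_fin] at h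
  refine h.trans ?_
  have b1 : ‖fun i => L (z i)‖ ≤ R :=
    (pi_norm_le_iff_of_nonneg hR).2 fun i => (L.unit_le_opNorm _ (hz i)).trans hL
  have b2 : ‖fun i => M (z i)‖ ≤ R :=
    (pi_norm_le_iff_of_nonneg hR).2 fun i => (M.unit_le_opNorm _ (hz i)).trans hM
  have b3 : ‖(fun i => L (z i)) - fun i => M (z i)‖ ≤ ‖L - M‖ :=
    (pi_norm_le_iff_of_nonneg (norm_nonneg _)).2 fun i => (L - M).unit_le_opNorm _ (hz i)
  gcongr
  exact max_le b1 b2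

theorem norm_le_altNorm_one (L : E →L[ℝ] E) : ‖L‖ ≤ altNorm 1 L := by
  refine L.opNorm_le_bound (altNorm_nonneg _ _) fun x => ?_
  obtain ⟨ψ, hψ, hx⟩ := exists_dual_vector'' ℝ (L x)
  have h1 : altPullback 1 L (ContinuousAlternatingMap.ofSubsingleton ℝ E ℝ (0 : Fin 1) ψ)
      (fun _ => x) = ‖L x‖ := hx
  have h2 := (altPullback 1 L
    (ContinuousAlternatingMap.ofSubsingleton ℝ E ℝ (0 : Fin 1) ψ)).le_opNorm (fun _ => x)
  rw [h1, norm_norm] at h2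
  refine h2.trans ?_
  rw [Finset.prod_const, Finset.card_univ, Fintype.card_fin, pow_one]
  gcongr
  refine ((altPullback 1 L).le_opNorm _).trans ?_
  rw [ContinuousAlternatingMap.norm_ofSubsingleton]
  exact mul_le_of_le_one_right (norm_nonneg _) hψ

/-- If the image of the unit ball is close to a finite set, then high-dimensional volumes are
strongly contracted. -/
theorem altNorm_le_of_finite_net (n : ℕ) (L : E →L[ℝ] E) (Y : Finset E) {H : ℝ} (hH : 1 ≤ H)
    (hY : ∀ y ∈ Y, ‖y‖ ≤ H)
    (hL : ∀ x : E, ‖x‖ ≤ 1 → ∃ y ∈ Y, ‖L x - y‖ ≤ 1 / 4) :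
    altNorm n L ≤ (1 / 2) ^ n * (4 * H) ^ Y.card := by
  classical
  refine altNorm_le_of_unit_ball L (by positivity) fun ω hω z hz => ?_
  choose y hyY hy using fun i => hL (z i) (hz i)
  have hsplit : (fun i => L (z i)) = y + fun i => L (z i) - y i := by
    funext i
    simp
  rw [hsplit, ω.map_add_univ]
  have hterm : ∀ s : Finset (Fin n), |ω (s.piecewise y fun i => L (z i) - y i)| ≤
      (1 / 4) ^ n * (4 * H) ^ Y.card := by
    intro s
    by_cases hs : s.card ≤ Y.card
    · calc |ω (s.piecewise y fun i => L (z i) - y i)|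
          ≤ ‖ω‖ * ∏ i, s.piecewise (fun _ => H) (fun _ => 1 / 4) i := by
            refine ω.le_opNorm_mul_prod_of_le fun i => ?_
            by_cases hi : i ∈ s
            · simpa [hi] using hY _ (hyY i)
            · simpa [hi] using hy i
        _ ≤ ∏ i, s.piecewise (fun _ => H) (fun _ => 1 / 4) i := by
            refine mul_le_of_le_one_left (Finset.prod_nonneg fun i _ => ?_) hω
            by_cases hi : i ∈ s
            · simpa [hi] using zero_le_one.trans hH
            · simp [hi]
        _ = H ^ s.card * (1 / 4) ^ (n - s.card) := by
            rw [Finset.prod_piecewise]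
            simp [Finset.prod_const, Finset.card_sdiff]
        _ = (1 / 4) ^ n * (4 * H) ^ s.card := by
            have hc : s.card ≤ n := by simpa using s.card_le_univ
            have hsplit : (1 / 4 : ℝ) ^ n = (1 / 4) ^ (n - s.card) * (1 / 4) ^ s.card := by
              rw [← pow_add, Nat.sub_add_cancel hc]
            rw [hsplit, mul_assoc, ← mul_pow]
            ring
        _ ≤ (1 / 4) ^ n * (4 * H) ^ Y.card := by
            gcongr
            linarith
    · push Not at hs
      obtain ⟨i, hi, j, hj, hij, heq⟩ :=
        Finset.exists_ne_map_eq_of_card_lt_of_maps_to hs fun i _ => hyY i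
      have hv : s.piecewise y (fun i => L (z i) - y i) i =
          s.piecewise y (fun i => L (z i) - y i) j := by
        rw [Finset.piecewise_eq_of_mem _ _ _ hi, Finset.piecewise_eq_of_mem _ _ _ hj, heq]
      rw [ω.map_eq_zero_of_eq _ hv hij, abs_zero]
      positivity
  calc |∑ s : Finset (Fin n), ω (s.piecewise y fun i => L (z i) - y i)|
      ≤ ∑ _s : Finset (Fin n), (1 / 4 : ℝ) ^ n * (4 * H) ^ Y.card :=
        (Finset.abs_sum_le_sum_abs _ _).trans (Finset.sum_le_sum fun s _ => hterm s)
    _ = (1 / 2) ^ n * (4 * H) ^ Y.card := by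
        rw [Finset.sum_const, Finset.card_univ, Fintype.card_finset, Fintype.card_fin,
          nsmul_eq_mul, ← mul_assoc]
        push_cast
        rw [← mul_pow]
        norm_num

end ExteriorAction

section RankOne

variable {E : Type*} [NormedAddCommGroup E] [NormedSpace ℝ E]

/-- Expansion of the wedge product of a linear functional and an alternating form. -/
theorem exists_wedge {n : ℕ} (ψ : E →L[ℝ] ℝ) (ω : E [⋀^Fin n]→L[ℝ] ℝ) :
    ∃ η : E [⋀^Fin (n + 1)]→L[ℝ] ℝ, ‖η‖ ≤ (n + 1) * (‖ψ‖ * ‖ω‖) ∧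
      ∀ (x : E) (z : Fin n → E), η (Fin.cons x z) =
        ψ x * ω z - ∑ i, ψ (z i) * ω (Function.update z i x) := by
  refine ⟨ContinuousAlternatingMap.alternatizeUncurryFin (ψ.smulRight ω), ?_, fun x z => ?_⟩
  · refine (ContinuousAlternatingMap.norm_alternatizeUncurryFin_le _).trans_eq ?_
    rw [ContinuousLinearMap.norm_smulRight_apply]
  · rw [ContinuousAlternatingMap.alternatizeUncurryFin_apply, Fin.sum_univ_succ, sub_eq_add_neg,
      ← Finset.sum_neg_distrib]
    congr 1
    · have h0 : Fin.removeNth 0 (Fin.cons x z : Fin (n + 1) → E) = z := by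
        rw [Fin.removeNth_zero, Fin.tail_cons]
      simp [h0]
    · refine Finset.sum_congr rfl fun i _ => ?_
      cases n with
      | zero => exact i.elim0
      | succ m =>
        have h1 : Fin.removeNth i.succ (Fin.cons x z : Fin (m + 2) → E) =
            Matrix.vecCons x (Fin.removeNth i z) := by
          funext j
          refine Fin.cases ?_ (fun j => ?_) j
          · simp [Fin.removeNth]
          · simp [Fin.removeNth]
        have h2 := ω.map_insertNth i x (Fin.removeNth i z)
        rw [Fin.insertNth_removeNth] at h2
        rw [h1, h2, ContinuousLinearMap.smulRight_apply, Fin.cons_succ, Fin.val_succ]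
        simp only [ContinuousAlternatingMap.smul_apply, smul_eq_mul]
        rw [pow_succ, zsmul_eq_mul, zsmul_eq_mul]
        push_cast
        ring

/-- An operator whose range is spanned by `n` vectors acts with rank one on `n`-forms. -/
theorem altPullback_eq_smulRight {n : ℕ} (F : E →L[ℝ] E) (c : Fin n → E →L[ℝ] ℝ) (w : Fin n → E)
    (hF : ∀ x, F x = ∑ i, c i x • w i) (ω : E [⋀^Fin n]→L[ℝ] ℝ) (hω : ω w ≠ 0) :
    altPullback n F = (ContinuousAlternatingMap.apply ℝ E ℝ w).smulRight
      ((ω w)⁻¹ • altPullback n F ω) := by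
  have key : ∀ (ω' : E [⋀^Fin n]→L[ℝ] ℝ) (x : Fin n → E), altPullback n F ω' x =
      ω' w * (Pi.basisFun ℝ (Fin n)).det fun j i => c i (x j) := by
    intro ω' x
    have h := congrArg (fun f => f fun j i => c i (x j))
      ((ω'.toAlternatingMap.compLinearMap (Fintype.linearCombination ℝ w)).eq_smul_basis_det
        (Pi.basisFun ℝ (Fin n)))
    have hl : (fun j => Fintype.linearCombination ℝ w fun i => c i (x j)) = fun j => F (x j) := by
      funext j
      rw [hF, Fintype.linearCombination_apply]
    have hr : (fun j => Fintype.linearCombination ℝ w (Pi.basisFun ℝ (Fin n) j)) = w := by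
      funext j
      simp [Fintype.linearCombination_apply, Pi.basisFun_apply, Pi.single_apply]
    have h' : ω' (fun j => Fintype.linearCombination ℝ w fun i => c i (x j)) =
        ω' (fun j => Fintype.linearCombination ℝ w (Pi.basisFun ℝ (Fin n) j)) *
          (Pi.basisFun ℝ (Fin n)).det fun j i => c i (x j) := h
    rw [hl, hr] at h'
    exact h'
  ext ω' x
  rw [key]
  change _ = ω' w * ((ω w)⁻¹ * altPullback n F ω x)
  rw [key ω x, inv_mul_cancel_left₀ hω]

/-- If `(n + 1)`-dimensional volumes are much more contracted than `n`-dimensional ones, then the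
operator is close to one acting with rank one on `n`-forms. -/
theorem exists_near_rank_one {n : ℕ} (L : E →L[ℝ] E) (hpos : 0 < altNorm n L) :
    ∃ (F : E →L[ℝ] E) (φ : (E [⋀^Fin n]→L[ℝ] ℝ) →L[ℝ] ℝ) (μ : E [⋀^Fin n]→L[ℝ] ℝ),
      ‖L - F‖ ≤ 2 * (n + 1) * altNorm (n + 1) L / altNorm n L ∧
        altPullback n F = φ.smulRight μ := by
  obtain ⟨ω, hω, z, hz, hβ⟩ : ∃ ω : E [⋀^Fin n]→L[ℝ] ℝ, ‖ω‖ ≤ 1 ∧ ∃ z : Fin n → E,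
      (∀ i, ‖z i‖ ≤ 1) ∧ altNorm n L / 2 < |ω fun i => L (z i)| := by
    by_contra! h
    have := altNorm_le_of_unit_ball L (half_pos hpos).le h
    linarith
  set w : Fin n → E := fun i => L (z i) with hw
  have hβ0 : 0 < |ω w| := (half_pos hpos).trans hβ
  have hne : ω w ≠ 0 := abs_pos.1 hβ0
  set c : Fin n → E →L[ℝ] ℝ := fun i => (ω w)⁻¹ • (ω.toContinuousLinearMap w i).comp L with hc
  have hcx : ∀ i x, c i x = (ω w)⁻¹ * ω (Function.update w i (L x)) := fun i x => rfl
  refine ⟨∑ i, (c i).smulRight (w i), _, _, ?_,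
    altPullback_eq_smulRight _ c w (fun x => by simp) ω hne⟩
  have hN := altNorm_nonneg (n + 1) L
  refine ContinuousLinearMap.opNorm_le_of_unit_norm (by positivity) fun x hx => ?_
  obtain ⟨ψ, hψ, hψx⟩ := exists_dual_vector'' ℝ ((L - ∑ i, (c i).smulRight (w i)) x)
  obtain ⟨η, hη, hηx⟩ := exists_wedge ψ ω
  have hval : η (fun i => L ((Fin.cons x z : Fin (n + 1) → E) i)) =
      ω w * ‖(L - ∑ i, (c i).smulRight (w i)) x‖ := by
    have hcons : (fun i => L ((Fin.cons x z : Fin (n + 1) → E) i)) = Fin.cons (L x) w := by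
      funext i
      refine Fin.cases rfl (fun i => rfl) i
    have hψx' : ψ ((L - ∑ i, (c i).smulRight (w i)) x) =
        ‖(L - ∑ i, (c i).smulRight (w i)) x‖ := hψx
    rw [hcons, hηx, ← hψx']
    simp only [sub_apply, sum_apply,
      ContinuousLinearMap.smulRight_apply, map_sub, map_sum, map_smul, smul_eq_mul, hcx, mul_sub,
      Finset.mul_sum]
    congr 1
    · ring
    · refine Finset.sum_congr rfl fun i _ => ?_
      field_simp
  have hη1 : ‖η‖ ≤ n + 1 := hη.trans
    (mul_le_of_le_one_right (by positivity) (mul_le_one₀ hψ (norm_nonneg _) hω))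
  have hle : |η (fun i => L ((Fin.cons x z : Fin (n + 1) → E) i))| ≤
      altNorm (n + 1) L * (n + 1) := by
    have h1 : ‖(Fin.cons x z : Fin (n + 1) → E)‖ ≤ 1 := by
      refine (pi_norm_le_iff_of_nonneg zero_le_one).2 fun i => ?_
      refine Fin.cases ?_ (fun i => ?_) i
      · exact hx.le
      · exact hz i
    calc _ ≤ ‖altPullback (n + 1) L η‖ := (altPullback (n + 1) L η).unit_le_opNorm h1
      _ ≤ altNorm (n + 1) L * ‖η‖ := (altPullback (n + 1) L).le_opNorm η
      _ ≤ _ := by gcongr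
  rw [hval, abs_mul, abs_norm] at hle
  rw [le_div_iff₀ hpos]
  nlinarith [norm_nonneg ((L - ∑ i, (c i).smulRight (w i)) x)]

/-- Norm comparison for products whose middle factor is close to a rank-one operator. -/
theorem norm_mul_mul_of_near_rank_one {V : Type*} [NormedAddCommGroup V] [NormedSpace ℝ V]
    (x y z : V →L[ℝ] V) (φ : V →L[ℝ] ℝ) (μ : V) {δ : ℝ} (hδ : ‖y - φ.smulRight μ‖ ≤ δ)
    (hδy : δ ≤ ‖y‖) :
    ‖x * y * z‖ * ‖y‖ ≤ ‖x * y‖ * ‖y * z‖ + 8 * δ * (‖x‖ * ‖y‖ * ‖z‖) ∧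
      ‖x * y‖ * ‖y * z‖ ≤ ‖x * y * z‖ * ‖y‖ + 8 * δ * (‖x‖ * ‖y‖ * ‖z‖) := by
  set k : V →L[ℝ] V := φ.smulRight μ with hk
  have hδ0 : 0 ≤ δ := (norm_nonneg _).trans hδ
  have hkey : ‖x * k * z‖ * ‖k‖ = ‖x * k‖ * ‖k * z‖ := by
    have h1 : x * k = φ.smulRight (x μ) := by
      ext v
      simp [hk]
    have h2 : k * z = (φ.comp z).smulRight μ := by
      ext v
      simp [hk]
    have h3 : x * k * z = (φ.comp z).smulRight (x μ) := by
      rw [h1]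
      ext v
      simp
    rw [h3, h1, h2, hk]
    simp only [ContinuousLinearMap.norm_smulRight_apply]
    ring
  have hxy : |‖x * y‖ - ‖x * k‖| ≤ ‖x‖ * δ := by
    refine (abs_norm_sub_norm_le _ _).trans ?_
    rw [← mul_sub]
    exact (norm_mul_le _ _).trans (by gcongr)
  have hyz : |‖y * z‖ - ‖k * z‖| ≤ δ * ‖z‖ := by
    refine (abs_norm_sub_norm_le _ _).trans ?_
    rw [← sub_mul]
    exact (norm_mul_le _ _).trans (by gcongr)
  have hxyz : |‖x * y * z‖ - ‖x * k * z‖| ≤ ‖x‖ * δ * ‖z‖ := by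
    refine (abs_norm_sub_norm_le _ _).trans ?_
    rw [← sub_mul, ← mul_sub]
    refine (norm_mul_le _ _).trans ?_
    gcongr
    exact (norm_mul_le _ _).trans (by gcongr)
  have hy : |‖y‖ - ‖k‖| ≤ δ := (abs_norm_sub_norm_le _ _).trans hδ
  have hxz : 0 ≤ ‖x‖ * ‖z‖ := by positivity
  have bxy : ‖x * y‖ ≤ ‖x‖ * ‖y‖ := norm_mul_le _ _
  have byz : ‖y * z‖ ≤ ‖y‖ * ‖z‖ := norm_mul_le _ _
  have bxyz : ‖x * y * z‖ ≤ ‖x‖ * ‖y‖ * ‖z‖ := (norm_mul_le _ _).trans (by gcongr)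
  have e1 : |‖x * y * z‖ * ‖y‖ - ‖x * k * z‖ * ‖k‖| ≤ 3 * δ * (‖x‖ * ‖y‖ * ‖z‖) := by
    have : ‖x * y * z‖ * ‖y‖ - ‖x * k * z‖ * ‖k‖ =
        ‖x * y * z‖ * (‖y‖ - ‖k‖) + (‖x * y * z‖ - ‖x * k * z‖) * ‖k‖ := by ring
    rw [this]
    calc _ ≤ |‖x * y * z‖ * (‖y‖ - ‖k‖)| + |(‖x * y * z‖ - ‖x * k * z‖) * ‖k‖| := abs_add_le _ _
      _ = ‖x * y * z‖ * |‖y‖ - ‖k‖| + |‖x * y * z‖ - ‖x * k * z‖| * ‖k‖ := by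
        rw [abs_mul, abs_mul, abs_norm, abs_norm]
      _ ≤ (‖x‖ * ‖y‖ * ‖z‖) * δ + (‖x‖ * δ * ‖z‖) * (2 * ‖y‖) := by
        gcongr
        linarith [(abs_le.1 hy).1]
      _ = _ := by ring
  have e2 : |‖x * y‖ * ‖y * z‖ - ‖x * k‖ * ‖k * z‖| ≤ 3 * δ * (‖x‖ * ‖y‖ * ‖z‖) := by
    have : ‖x * y‖ * ‖y * z‖ - ‖x * k‖ * ‖k * z‖ =
        ‖x * y‖ * (‖y * z‖ - ‖k * z‖) + (‖x * y‖ - ‖x * k‖) * ‖k * z‖ := by ring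
    rw [this]
    calc _ ≤ |‖x * y‖ * (‖y * z‖ - ‖k * z‖)| + |(‖x * y‖ - ‖x * k‖) * ‖k * z‖| := abs_add_le _ _
      _ = ‖x * y‖ * |‖y * z‖ - ‖k * z‖| + |‖x * y‖ - ‖x * k‖| * ‖k * z‖ := by
        rw [abs_mul, abs_mul, abs_norm, abs_norm]
      _ ≤ (‖x‖ * ‖y‖) * (δ * ‖z‖) + (‖x‖ * δ) * (2 * ‖y‖ * ‖z‖) := by
        gcongr
        nlinarith [(abs_le.1 hyz).1, norm_nonneg z]
      _ = _ := by ring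
  have hnn : 0 ≤ δ * (‖x‖ * ‖y‖ * ‖z‖) := by positivity
  rw [hkey] at e1
  constructor <;> linarith [abs_le.1 e1, abs_le.1 e2, (abs_le.1 e1).1, (abs_le.1 e1).2,
    (abs_le.1 e2).1, (abs_le.1 e2).2]

end RankOne

section RecurrentWords

variable {M : Type*} [Monoid M]

theorem half_mul_le_of_mul_le_add {u p v w e c : ℝ} (h : u * p ≤ v * w + e)
    (he : e ≤ u * p / 2) (hc : c * v ≤ u) (hv : 0 < v) (hp : 0 ≤ p) : c / 2 * p ≤ w := by
  have h1 : v * (c / 2 * p) ≤ v * w := by nlinarith [mul_le_mul_of_nonneg_right hc hp]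
  exact le_of_mul_le_mul_left h1 hv

theorem pow_mul_le_of_log_le {s x y : ℝ} {i k d : ℕ} (hs : 0 < s) (hx : 0 < x) (hy : 0 < y)
    (hk : k = i + d)
    (h : Real.log x + 7 * -Real.log s * i ≤ Real.log y + 7 * -Real.log s * k) :
    s ^ (7 * d) * x ≤ y := by
  rw [← Real.log_le_log_iff (by positivity) hy, Real.log_mul (by positivity) hx.ne', Real.log_pow]
  subst hk
  push_cast at h ⊢
  linarith

theorem pow_le_half_mul_pow {s : ℝ} (hs : 0 < s) (hs2 : s ≤ 1 / 2) {m n : ℕ} (h : n + 2 ≤ m) :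
    s ^ m * s⁻¹ ≤ s ^ n / 2 := by
  obtain ⟨k, rfl⟩ := Nat.exists_eq_add_of_le h
  have h1 : s ^ k ≤ 1 := pow_le_one₀ hs.le (by linarith)
  have h2 : s ^ (n + 2 + k) * s⁻¹ = s ^ n * (s ^ k * s) := by
    field_simp
    ring
  have h3 : s ^ k * s ≤ 1 / 2 := by nlinarith
  rw [h2]
  nlinarith [pow_pos hs n]

/-- A recurrence argument: a long word of nearly extremal norm has a subword which follows itself
without much loss of norm. -/
theorem exists_recurrent_word (N : M → ℝ) (hN : ∀ x, 0 ≤ N x) (hN1 : N 1 ≤ 1)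
    (hNmul : ∀ x y, N (x * y) ≤ N x * N y) {s : ℝ} (hs : 0 < s) (hs2 : s ≤ 1 / 2) (S : Set M)
    (hS : ∀ b ∈ S, N b ≤ s⁻¹)
    (hlong : ∀ K ≥ 1, ∃ b : ℕ → M, (∀ i, b i ∈ S) ∧ s ≤ N (wordProd b 0 K))
    (q : ℕ) (col : M → Fin q) (hcol : ∀ b ∈ S, ∀ b' ∈ S, col b = col b' →
      ∀ P, N (P * b') ≤ N (P * b) + s ^ 7 / 4 * N P)
    (hT : ∀ (b : ℕ → M) (j n : ℕ), (∀ i, b i ∈ S) → 1 ≤ n → s ^ (7 * n) ≤ N (wordProd b j n) →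
      ∀ X Z, N (X * wordProd b j n * Z) * N (wordProd b j n) ≤
        N (X * wordProd b j n) * N (wordProd b j n * Z) +
          s ^ (30 * n) * (N X * N (wordProd b j n) * N Z)) :
    ∃ (b : ℕ → M) (j n : ℕ), (∀ i, b i ∈ S) ∧ s ^ (7 * (n + 1)) ≤ N (wordProd b j (n + 1)) ∧
      s ^ 7 ≤ N (b j) ∧
      s ^ 7 / 4 * N (wordProd b j (n + 1)) ≤ N (wordProd b j (n + 1) * b j) ∧
      s ^ 7 / 2 * N (wordProd b (j + 1) n) ≤ N (wordProd b j (n + 1)) := by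
  set K := 2 * q + 8 with hK
  obtain ⟨b, hb, hbK⟩ := hlong K (by omega)
  have hL : 0 < -Real.log s := by
    have := Real.log_neg hs (by linarith)
    linarith
  have hpos : ∀ i ≤ K, 0 < N (wordProd b 0 i) ∧ 0 < N (wordProd b i (K - i)) := by
    intro i hi
    have h1 : 0 < N (wordProd b 0 i) * N (wordProd b i (K - i)) := by
      have h2 := hNmul (wordProd b 0 i) (wordProd b (0 + i) (K - i))
      rw [← wordProd_add, Nat.add_sub_cancel' hi, zero_add] at h2
      linarith
    exact ⟨pos_of_mul_pos_left h1 (hN _), pos_of_mul_pos_right h1 (hN _)⟩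
  have hpos' : ∀ t ≤ K, 0 < N (wordProd b (K - t) t) := by
    intro t ht
    have := (hpos (K - t) (by omega)).2
    rwa [Nat.sub_sub_self ht] at this
  have hlog : ∀ {x y}, 0 < x → 0 < y → y ≤ s⁻¹ * x → Real.log y ≤ Real.log x + -Real.log s := by
    intro x y hx hy h
    have := Real.log_le_log hy h
    rw [Real.log_mul (by positivity) hx.ne', Real.log_inv] at this
    linarith
  have hlogK : Real.log s ≤ Real.log (N (wordProd b 0 K)) := Real.log_le_log hs hbK
  have hlog1 : Real.log (N 1) ≤ 0 := Real.log_nonpos (hN _) hN1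
  have hfront : ∀ i < K, wordProd b (K - (i + 1)) (i + 1) =
      b (K - (i + 1)) * wordProd b (K - i) i := by
    intro i hi
    rw [wordProd_succ', show K - (i + 1) + 1 = K - i by omega]
  obtain ⟨j, l, hjl, hlK, hjlc, haj, hal, haj', hal'⟩ := exists_good_pair
    (fun i => Real.log (N (wordProd b 0 i)) + 7 * -Real.log s * i)
    (fun t => Real.log (N (wordProd b (K - t) t)) + 7 * -Real.log s * t) hL K q le_rfl
    (by
      intro i hi
      have := hlog (hpos i hi.le).1 (hpos (i + 1) hi).1 (by
        rw [wordProd_succ, mul_comm s⁻¹]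
        exact (hNmul _ _).trans (mul_le_mul_of_nonneg_left (hS _ (hb _)) (hN _)))
      push_cast
      linarith)
    (by
      intro i hi
      have := hlog (hpos' i hi.le) (hpos' (i + 1) hi) (by
        rw [hfront i hi]
        exact (hNmul _ _).trans (mul_le_mul_of_nonneg_right (hS _ (hb _)) (hN _)))
      push_cast
      linarith)
    (by
      simp only [wordProd_zero, Nat.cast_zero]
      linarith)
    (by
      simp only [wordProd_zero, Nat.cast_zero, Nat.sub_self]
      linarith)
    (fun i => col (b i))
  have hfw : ∀ i d, i + d ≤ K →
      (∀ s', i < s' → s' ≤ K → Real.log (N (wordProd b 0 i)) + 7 * -Real.log s * i ≤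
        Real.log (N (wordProd b 0 s')) + 7 * -Real.log s * s') →
      s ^ (7 * d) * N (wordProd b 0 i) ≤ N (wordProd b 0 (i + d)) := by
    intro i d hd h
    rcases d.eq_zero_or_pos with rfl | hd0
    · simp
    exact pow_mul_le_of_log_le hs (hpos i (by omega)).1 (hpos _ hd).1 rfl (h _ (by omega) hd)
  have hbw : ∀ i d, i + d ≤ K →
      (∀ s', K - (i + d) < s' → s' ≤ K →
        Real.log (N (wordProd b (K - (K - (i + d))) (K - (i + d)))) +
          7 * -Real.log s * (K - (i + d) : ℕ) ≤
        Real.log (N (wordProd b (K - s') s')) + 7 * -Real.log s * s') →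
      s ^ (7 * d) * N (wordProd b (i + d) (K - (i + d))) ≤ N (wordProd b i (K - i)) := by
    intro i d hd h
    rcases d.eq_zero_or_pos with rfl | hd0
    · simp
    have h1 := h (K - i) (by omega) (by omega)
    rw [Nat.sub_sub_self hd, Nat.sub_sub_self (show i ≤ K by omega)] at h1
    exact pow_mul_le_of_log_le hs (hpos _ hd).2 (hpos i (by omega)).2 (by omega) h1
  obtain ⟨n, rfl⟩ := Nat.exists_eq_add_of_lt hjl
  have hjpos := (hpos j (by omega)).1
  have hword : ∀ d, j + d ≤ K → s ^ (7 * d) ≤ N (wordProd b j d) := by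
    intro d hd
    have h1 := hfw j d hd haj
    rw [wordProd_add, zero_add, mul_comm] at h1
    exact le_of_mul_le_mul_left (h1.trans (hNmul _ _)) hjpos
  have hP : s ^ (7 * (n + 1)) ≤ N (wordProd b j (n + 1)) := hword _ (by omega)
  have hbj : s ^ 7 ≤ N (b j) := by
    have := hword 1 (by omega)
    rwa [wordProd_one] at this
  refine ⟨b, j, n, hb, hP, hbj, ?_, ?_⟩
  · have h1 := hT b j (n + 1) hb (by omega) hP (wordProd b 0 j) (b (j + (n + 1)))
    have e1 : wordProd b 0 j * wordProd b j (n + 1) = wordProd b 0 (j + n + 1) := by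
      rw [add_assoc, wordProd_add b 0 j (n + 1), zero_add]
    have e2 : wordProd b 0 (j + n + 1) * b (j + (n + 1)) = wordProd b 0 (j + n + 1 + 1) := by
      rw [wordProd_succ b 0 (j + n + 1), zero_add, add_assoc]
    rw [e1, e2] at h1
    have h2 := half_mul_le_of_mul_le_add (c := s ^ 7) h1 ?_ ?_ (hpos _ hlK.le).1 (hN _)
    · have h3 := hcol _ (hb j) _ (hb (j + (n + 1))) hjlc (wordProd b j (n + 1))
      linarith
    · have h3 := hfw j (n + 1 + 1) (by omega) haj
      have h4 := pow_le_half_mul_pow hs hs2 (show 7 * (n + 1 + 1) + 2 ≤ 30 * (n + 1) by omega)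
      have h5 := hS _ (hb (j + (n + 1)))
      calc s ^ (30 * (n + 1)) *
            (N (wordProd b 0 j) * N (wordProd b j (n + 1)) * N (b (j + (n + 1))))
          ≤ s ^ (30 * (n + 1)) * (N (wordProd b 0 j) * N (wordProd b j (n + 1)) * s⁻¹) := by
            have := hN (wordProd b j (n + 1))
            gcongr
        _ = s ^ (30 * (n + 1)) * s⁻¹ * (N (wordProd b 0 j) * N (wordProd b j (n + 1))) := by ring
        _ ≤ s ^ (7 * (n + 1 + 1)) / 2 * (N (wordProd b 0 j) * N (wordProd b j (n + 1))) := by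
            have := hN (wordProd b j (n + 1))
            gcongr
        _ = s ^ (7 * (n + 1 + 1)) * N (wordProd b 0 j) * N (wordProd b j (n + 1)) / 2 := by ring
        _ ≤ _ := by
            have := hN (wordProd b j (n + 1))
            gcongr
            exact h3
    · simpa using hfw (j + n + 1) 1 hlK hal
  · rcases n.eq_zero_or_pos with rfl | hn
    · rw [wordProd_zero, zero_add, wordProd_one]
      nlinarith [pow_pos hs 7, hN 1]
    have e1 : b j * wordProd b (j + 1) n = wordProd b j (n + 1) := (wordProd_succ' b j n).symm
    have e2 : wordProd b (j + 1) n * wordProd b (j + n + 1) (K - (j + n + 1)) =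
        wordProd b (j + 1) (K - (j + 1)) := by
      rw [show K - (j + 1) = n + (K - (j + n + 1)) by omega, wordProd_add,
        show j + 1 + n = j + n + 1 by omega]
    have e3 : wordProd b j (n + 1) * wordProd b (j + n + 1) (K - (j + n + 1)) =
        wordProd b j (K - j) := by
      rw [show K - j = n + 1 + (K - (j + n + 1)) by omega,
        wordProd_add b j (n + 1), ← add_assoc]
    have hX : s ^ (7 * n) ≤ N (wordProd b (j + 1) n) := by
      have h1 := hbw (j + 1) n (by omega) (by
        rw [show j + 1 + n = j + n + 1 by omega]
        exact hal')
      rw [show j + 1 + n = j + n + 1 by omega, ← e2] at h1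
      exact le_of_mul_le_mul_right (h1.trans (hNmul _ _)) (hpos _ hlK.le).2
    have h1 := hT b (j + 1) n hb hn hX (b j) (wordProd b (j + n + 1) (K - (j + n + 1)))
    rw [e1, e2, e3, mul_comm (N (wordProd b j (n + 1)))] at h1
    refine half_mul_le_of_mul_le_add h1 ?_ ?_ (hpos (j + 1) (by omega)).2 (hN _)
    · have h3 := hbw j (n + 1) (by omega) hal'
      rw [← add_assoc] at h3
      have h4 := pow_le_half_mul_pow hs hs2 (show 7 * (n + 1) + 2 ≤ 30 * n by omega)
      have h5 := hS _ (hb j)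
      set x := N (wordProd b (j + 1) n)
      set z := N (wordProd b (j + n + 1) (K - (j + n + 1)))
      have hx : 0 ≤ x := hN _
      have hz : 0 ≤ z := hN _
      calc s ^ (30 * n) * (N (b j) * x * z)
          ≤ s ^ (30 * n) * (s⁻¹ * x * z) := by gcongr
        _ = s ^ (30 * n) * s⁻¹ * (x * z) := by ring
        _ ≤ s ^ (7 * (n + 1)) / 2 * (x * z) := by gcongr
        _ = s ^ (7 * (n + 1)) * z * x / 2 := by ring
        _ ≤ _ := by gcongr
    · simpa using hbw j 1 (by omega) haj'

/-- A recurrent word has large powers. -/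
theorem exists_word_pow_ge (N : M → ℝ) (hN : ∀ x, 0 ≤ N x) (hN1 : N 1 ≤ 1)
    (hNmul : ∀ x y, N (x * y) ≤ N x * N y) {s : ℝ} (hs : 0 < s) (hs2 : s ≤ 1 / 2) (S : Set M)
    (hS : ∀ b ∈ S, N b ≤ s⁻¹)
    (hlong : ∀ K ≥ 1, ∃ b : ℕ → M, (∀ i, b i ∈ S) ∧ s ≤ N (wordProd b 0 K))
    (q : ℕ) (col : M → Fin q) (hcol : ∀ b ∈ S, ∀ b' ∈ S, col b = col b' →
      ∀ P, N (P * b') ≤ N (P * b) + s ^ 7 / 4 * N P)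
    (hT : ∀ (b : ℕ → M) (j n : ℕ), (∀ i, b i ∈ S) → 1 ≤ n → s ^ (7 * n) ≤ N (wordProd b j n) →
      ∀ X Z, (N (X * wordProd b j n * Z) * N (wordProd b j n) ≤
          N (X * wordProd b j n) * N (wordProd b j n * Z) +
            s ^ (30 * n) * (N X * N (wordProd b j n) * N Z)) ∧
        N (X * wordProd b j n) * N (wordProd b j n * Z) ≤
          N (X * wordProd b j n * Z) * N (wordProd b j n) +
            s ^ (30 * n) * (N X * N (wordProd b j n) * N Z)) :
    ∃ (b : ℕ → M) (j n : ℕ), (∀ i, b i ∈ S) ∧ 1 ≤ n ∧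
      ∀ m ≥ 1, s ^ (18 * n * m) ≤ N (wordProd b j n ^ m) := by
  obtain ⟨b, j, n, hb, hP, hbj, hPb, hPX⟩ := exists_recurrent_word N hN hN1 hNmul hs hs2 S hS hlong
    q col hcol fun b j n hb hn h X Z => (hT b j n hb hn h X Z).1
  refine ⟨b, j, n + 1, hb, by omega, ?_⟩
  set P := wordProd b j (n + 1) with hPdef
  set X := wordProd b (j + 1) n
  have hPeq : P = b j * X := wordProd_succ' b j n
  have hs8 : s ^ 7 ≤ 1 / 128 := (pow_le_pow_left₀ hs.le hs2 7).trans (by norm_num)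
  have hstep : ∀ m, s ^ 8 / 8 * (N P * N (P ^ m)) ≤ N (P ^ (m + 1)) := by
    intro m
    induction m with
    | zero =>
      rw [pow_zero, zero_add, pow_one]
      have h1 : N P * N 1 ≤ N P := mul_le_of_le_one_right (hN _) hN1
      have h2 : s ^ 8 ≤ 1 := pow_le_one₀ hs.le (by linarith)
      nlinarith [hN P, hN 1, mul_nonneg (hN P) (hN 1)]
    | succ m ih =>
      have h1 := (hT b j 1 hb le_rfl (by rwa [wordProd_one]) P (X * P ^ m)).2
      rw [wordProd_one, ← mul_assoc (b j), ← hPeq, mul_assoc P (b j), ← mul_assoc (b j), ← hPeq,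
        ← pow_succ', ← pow_succ'] at h1
      have hbs := hS _ (hb j)
      have h2 : N (X * P ^ m) ≤ N X * N (P ^ m) := hNmul _ _
      have h3 : s ^ 7 / 2 * N X * N (P ^ m) ≤ N P * N (P ^ m) :=
        mul_le_mul_of_nonneg_right hPX (hN _)
      have h4 : s ^ 15 * N (X * P ^ m) ≤ 16 * N (P ^ (m + 1)) := by
        calc s ^ 15 * N (X * P ^ m) ≤ s ^ 15 * (N X * N (P ^ m)) := by gcongr
          _ = 2 * s ^ 8 * (s ^ 7 / 2 * N X * N (P ^ m)) := by ring
          _ ≤ 2 * s ^ 8 * (N P * N (P ^ m)) := by gcongr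
          _ = 16 * (s ^ 8 / 8 * (N P * N (P ^ m))) := by ring
          _ ≤ _ := by gcongr
      have hp := hN P
      have hv := hN (P ^ (m + 1))
      have hw := hN (P ^ (m + 1 + 1))
      have hx := hN (X * P ^ m)
      have h5 : s ^ 7 / 4 * N P * N (P ^ (m + 1)) ≤
          N (P ^ (m + 1 + 1)) * s⁻¹ + s ^ (30 * 1) * (N P * s⁻¹ * N (X * P ^ m)) :=
        (mul_le_mul_of_nonneg_right hPb hv).trans (h1.trans (by gcongr))
      have h6 : s ^ (30 * 1) * (N P * s⁻¹ * N (X * P ^ m)) ≤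
          s ^ 7 / 8 * (N P * N (P ^ (m + 1))) := by
        calc s ^ (30 * 1) * (N P * s⁻¹ * N (X * P ^ m))
            = s ^ 14 * N P * (s ^ 15 * N (X * P ^ m)) := by
              field_simp
              ring
          _ ≤ s ^ 14 * N P * (16 * N (P ^ (m + 1))) := by gcongr
          _ = s ^ 7 * (16 * s ^ 7) * (N P * N (P ^ (m + 1))) := by ring
          _ ≤ s ^ 7 * (1 / 8) * (N P * N (P ^ (m + 1))) := by
              gcongr
              linarith
          _ = _ := by ring
      have h7 : s ^ 7 / 8 * (N P * N (P ^ (m + 1))) ≤ N (P ^ (m + 1 + 1)) * s⁻¹ := by linarith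
      calc s ^ 8 / 8 * (N P * N (P ^ (m + 1)))
          = s * (s ^ 7 / 8 * (N P * N (P ^ (m + 1)))) := by ring
        _ ≤ s * (N (P ^ (m + 1 + 1)) * s⁻¹) := by gcongr
        _ = _ := by field_simp
  have hs11 : s ^ 11 ≤ s ^ 8 / 8 := by
    have : s ^ 3 ≤ 1 / 8 := (pow_le_pow_left₀ hs.le hs2 3).trans (by norm_num)
    calc s ^ 11 = s ^ 8 * s ^ 3 := by ring
      _ ≤ s ^ 8 * (1 / 8) := by gcongr
      _ = _ := by ring
  have hle : ∀ k l : ℕ, k ≤ l → s ^ l ≤ s ^ k := fun k l h =>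
    pow_le_pow_of_le_one hs.le (by linarith) h
  intro m hm
  induction m, hm using Nat.le_induction with
  | base =>
    rw [pow_one, mul_one]
    exact (hle _ _ (by omega)).trans hP
  | succ m hm ih =>
    refine le_trans ?_ (hstep m)
    calc s ^ (18 * (n + 1) * (m + 1)) ≤ s ^ (11 + (7 * (n + 1) + 18 * (n + 1) * m)) :=
          hle _ _ (by nlinarith)
      _ = s ^ 11 * (s ^ (7 * (n + 1)) * s ^ (18 * (n + 1) * m)) := by rw [pow_add, pow_add]
      _ ≤ s ^ 8 / 8 * (N P * N (P ^ m)) := by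
          have := hN P
          gcongr

end RecurrentWords

section Prods

variable {R : Type*} [NormedRing R] {A : Set R}

theorem mem_prods_zero {P : R} : P ∈ prods A 0 ↔ P = 1 := by
  simp [prods]

theorem mem_prods_succ {P : R} {n : ℕ} :
    P ∈ prods A (n + 1) ↔ ∃ x ∈ A, ∃ Q ∈ prods A n, P = x * Q := by
  constructor
  · rintro ⟨f, hf, rfl⟩
    exact ⟨f 0, hf 0, _, ⟨fun i => f i.succ, fun i => hf _, rfl⟩, by
      rw [List.ofFn_succ, List.prod_cons]⟩
  · rintro ⟨x, hx, Q, ⟨f, hf, rfl⟩, rfl⟩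
    refine ⟨Fin.cons x f, Fin.cases hx hf, ?_⟩
    rw [List.ofFn_succ, List.prod_cons]
    simp

theorem mul_mem_prods {P Q : R} {m n : ℕ} (hP : P ∈ prods A m) (hQ : Q ∈ prods A n) :
    P * Q ∈ prods A (m + n) := by
  induction m generalizing P with
  | zero =>
    rw [mem_prods_zero] at hP
    simpa [hP] using hQ
  | succ m ih =>
    obtain ⟨x, hx, P', hP', rfl⟩ := mem_prods_succ.1 hP
    rw [mul_assoc, Nat.succ_add]
    exact mem_prods_succ.2 ⟨x, hx, _, ih hP', rfl⟩

theorem wordProd_mem_prods {b : ℕ → R} {m : ℕ} (hb : ∀ i, b i ∈ prods A m) (j n : ℕ) :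
    wordProd b j n ∈ prods A (m * n) := by
  induction n with
  | zero => exact mem_prods_zero.2 rfl
  | succ n ih => exact mul_mem_prods ih (hb _)

theorem mem_prods_one {x : R} (hx : x ∈ A) : x ∈ prods A 1 :=
  mem_prods_succ.2 ⟨x, hx, 1, mem_prods_zero.2 rfl, (mul_one x).symm⟩

theorem wordProd_mem_prods' {a : ℕ → R} (ha : ∀ i, a i ∈ A) (j n : ℕ) :
    wordProd a j n ∈ prods A n := by
  simpa using wordProd_mem_prods (fun i => mem_prods_one (ha i)) j n

theorem pow_mem_prods {P : R} {m : ℕ} (hP : P ∈ prods A m) (n : ℕ) : P ^ n ∈ prods A (m * n) := by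
  induction n with
  | zero => exact mem_prods_zero.2 (pow_zero P)
  | succ n ih =>
    rw [pow_succ]
    exact mul_mem_prods ih hP

theorem exists_wordProd_of_mem_prods (hA : A.Nonempty) {P : R} {n : ℕ} (hP : P ∈ prods A n) :
    ∃ a : ℕ → R, (∀ i, a i ∈ A) ∧ P = wordProd a 0 n := by
  obtain ⟨f, hf, rfl⟩ := hP
  obtain ⟨x, hx⟩ := hA
  refine ⟨fun i => if h : i < n then f ⟨i, h⟩ else x, fun i => ?_, ?_⟩
  · dsimp only
    split_ifs
    exacts [hf _, hx]
  · have key : ∀ (a : ℕ → R) (n j : ℕ),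
        (List.ofFn fun i : Fin n => a (j + i)).prod = wordProd a j n := by
      intro a n
      induction n with
      | zero => simp [wordProd_zero]
      | succ n ih =>
        intro j
        rw [List.ofFn_succ, List.prod_cons, wordProd_succ', ← ih]
        simp [add_assoc, add_comm 1]
    rw [← key]
    simp

theorem prods_nonempty (hA : A.Nonempty) (n : ℕ) : (prods A n).Nonempty := by
  obtain ⟨x, hx⟩ := hA
  exact ⟨_, wordProd_mem_prods' (a := fun _ => x) (fun _ => hx) 0 n⟩

theorem apply_le_pow_of_mem_prods (hA : A.Nonempty) (N : R → ℝ) (hN : ∀ x, 0 ≤ N x)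
    (hN1 : N 1 ≤ 1) (hNmul : ∀ x y, N (x * y) ≤ N x * N y) {m : ℕ} {κ : ℝ}
    (h : ∀ P ∈ prods A m, N P ≤ κ) {n : ℕ} {P : R} (hP : P ∈ prods A (m * n)) : N P ≤ κ ^ n := by
  obtain ⟨a, ha, rfl⟩ := exists_wordProd_of_mem_prods hA hP
  clear hP
  induction n with
  | zero => exact hN1
  | succ n ih =>
    rw [Nat.mul_succ, wordProd_add, pow_succ]
    exact (hNmul _ _).trans (mul_le_mul ih (h _ (wordProd_mem_prods' ha _ _)) (hN _)
      ((hN _).trans ih))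

theorem exists_isCompact_prods_subset (hA : IsCompact (closure A)) (n : ℕ) :
    ∃ K, IsCompact K ∧ prods A n ⊆ K := by
  induction n with
  | zero => exact ⟨{1}, isCompact_singleton, fun P hP => mem_prods_zero.1 hP⟩
  | succ n ih =>
    obtain ⟨K, hK, hsub⟩ := ih
    refine ⟨(fun x : R × R => x.1 * x.2) '' (closure A ×ˢ K), (hA.prod hK).image continuous_mul, ?_⟩
    intro P hP
    obtain ⟨x, hx, Q, hQ, rfl⟩ := mem_prods_succ.1 hP
    exact ⟨(x, Q), ⟨subset_closure hx, hsub hQ⟩, rfl⟩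

end Prods

section Core

theorem exists_finite_net {V : Type*} [NormedAddCommGroup V] {S K : Set V} (hK : IsCompact K)
    (hS : S ⊆ K) {ε : ℝ} (hε : 0 < ε) :
    ∃ t ⊆ S, t.Finite ∧ ∀ x ∈ S, ∃ y ∈ t, ‖x - y‖ < ε := by
  obtain ⟨t, hsub, hfin, ht⟩ :=
    Metric.finite_approx_of_totallyBounded (hK.totallyBounded.subset hS) ε hε
  refine ⟨t, hsub, hfin, fun x hx => ?_⟩
  obtain ⟨y, hy, h⟩ := Set.mem_iUnion₂.1 (ht hx)
  exact ⟨y, hy, mem_ball_iff_norm.1 h⟩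

variable {E : Type*} [NormedAddCommGroup E] [NormedSpace ℝ E] {A : Set (E →L[ℝ] E)}

/-- If the products of length `m` are uniformly close to compact, then they contract volumes of
some high dimension. -/
theorem exists_altNorm_le_half (hA : IsCompact (closure A)) (m : ℕ)
    (hnet : ∀ P ∈ prods A m, ∃ S : Finset E,
      P '' Metric.closedBall 0 1 ⊆ ⋃ y ∈ S, Metric.ball y (1 / 8)) :
    ∃ q, ∀ P ∈ prods A m, altNorm (q + 1) P ≤ 1 / 2 := by
  classical
  obtain ⟨K, hK, hsub⟩ := exists_isCompact_prods_subset hA m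
  obtain ⟨t, htsub, htfin, ht⟩ := exists_finite_net hK hsub (by norm_num : (0 : ℝ) < 1 / 8)
  choose! S hS using hnet
  set Y := htfin.toFinset.biUnion S with hYdef
  set H := 1 + ∑ y ∈ Y, ‖y‖
  have hH : 1 ≤ H := le_add_of_nonneg_right (Finset.sum_nonneg fun _ _ => norm_nonneg _)
  have hY : ∀ y ∈ Y, ‖y‖ ≤ H := fun y hy =>
    (Finset.single_le_sum (f := fun y => ‖y‖) (fun _ _ => norm_nonneg _) hy).trans
      (le_add_of_nonneg_left zero_le_one)
  have hpos : 0 < (4 * H) ^ Y.card := by positivity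
  obtain ⟨q, hq⟩ := exists_pow_lt_of_lt_one (inv_pos.2 hpos) (by norm_num : (1 / 2 : ℝ) < 1)
  refine ⟨q, fun P hP => (altNorm_le_of_finite_net (q + 1) P Y hH hY fun x hx => ?_).trans ?_⟩
  · obtain ⟨Q, hQ, hPQ⟩ := ht P hP
    obtain ⟨y, hy, hQy⟩ := Set.mem_iUnion₂.1
      (hS Q (htsub hQ) (Set.mem_image_of_mem Q (mem_closedBall_zero_iff.2 hx)))
    refine ⟨y, Finset.mem_biUnion.2 ⟨Q, htfin.mem_toFinset.2 hQ, hy⟩, ?_⟩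
    rw [mem_ball_iff_norm] at hQy
    have h1 : ‖(P - Q) x‖ ≤ 1 / 8 := ((P - Q).unit_le_opNorm x hx).trans hPQ.le
    calc ‖P x - y‖ = ‖(P - Q) x + (Q x - y)‖ := by
          rw [sub_apply]
          abel_nf
      _ ≤ 1 / 4 := (norm_add_le _ _).trans (by linarith)
  · have h1 : (1 / 2 : ℝ) ^ q * (4 * H) ^ Y.card ≤ 1 := by
      have := mul_le_mul_of_nonneg_right hq.le hpos.le
      rwa [inv_mul_cancel₀ hpos.ne'] at this
    rw [pow_succ]
    linarith

/-- There is a largest dimension whose volumes are not uniformly contracted. -/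
theorem exists_critical_dimension (hA : IsCompact (closure A))
    (hlow : ∀ m ≥ 1, ∀ c < 1, ∃ P ∈ prods A m, c < ‖P‖)
    (hnet : ∃ m ≥ 1, ∀ P ∈ prods A m, ∃ S : Finset E,
      P '' Metric.closedBall 0 1 ⊆ ⋃ y ∈ S, Metric.ball y (1 / 8)) :
    ∃ p ≥ 1, (∀ m ≥ 1, ∃ P ∈ prods A m, 1 / 2 < altNorm p P) ∧
      ∃ m ≥ 1, ∃ κ < 1, ∀ P ∈ prods A m, altNorm (p + 1) P ≤ κ := by
  classical
  have hex : ∃ q, ∃ m ≥ 1, ∃ κ < 1, ∀ P ∈ prods A m, altNorm (q + 1) P ≤ κ := by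
    obtain ⟨m, hm, h⟩ := hnet
    obtain ⟨q, hq⟩ := exists_altNorm_le_half hA m h
    exact ⟨q, m, hm, 1 / 2, by norm_num, hq⟩
  set p := Nat.find hex with hp
  have hspec := Nat.find_spec hex
  rw [← hp] at hspec
  have hp1 : 1 ≤ p := by
    by_contra h0
    obtain ⟨m, hm, κ, hκ, h⟩ := hspec
    obtain ⟨P, hP, hPn⟩ := hlow m hm κ hκ
    have h1 := h P hP
    rw [show p = 0 by omega] at h1
    linarith [norm_le_altNorm_one P]
  refine ⟨p, hp1, fun m hm => ?_, hspec⟩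
  have hnot := Nat.find_min hex (show p - 1 < Nat.find hex by omega)
  rw [show p - 1 + 1 = p by omega] at hnot
  by_contra! hcon
  exact hnot ⟨m, hm, 1 / 2, by norm_num, hcon⟩

/-- If volumes of dimension `p + 1` are much smaller than those of dimension `p`, the growth of
`p`-dimensional volumes is nearly multiplicative across the operator. -/
theorem altNorm_mul_mul_estimate {p : ℕ} (hp : 1 ≤ p) (Y : E →L[ℝ] E) {σ ϱ : ℝ} (hσ : 0 < σ)
    (hϱ : 1 ≤ ϱ) (hσϱ : ϱ ^ p * σ = 1) (hY : ‖Y‖ ≤ ϱ) (hYp : σ ^ 7 ≤ altNorm p Y)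
    (hYp1 : altNorm (p + 1) Y ≤ σ ^ 39) (hsmall : 16 * p * (p + 1) * 2 ^ p * σ ≤ 1)
    (X Z : E →L[ℝ] E) :
    altNorm p (X * Y * Z) * altNorm p Y ≤ altNorm p (X * Y) * altNorm p (Y * Z) +
        σ ^ 30 * (altNorm p X * altNorm p Y * altNorm p Z) ∧
      altNorm p (X * Y) * altNorm p (Y * Z) ≤ altNorm p (X * Y * Z) * altNorm p Y +
        σ ^ 30 * (altNorm p X * altNorm p Y * altNorm p Z) := by
  have hpR : (1 : ℝ) ≤ p := by exact_mod_cast hp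
  have h2p : (1 : ℝ) ≤ 2 ^ p := one_le_pow₀ (by norm_num)
  have hYpos : 0 < altNorm p Y := (pow_pos hσ 7).trans_le hYp
  obtain ⟨F, φ, μ, hF, hFr⟩ := exists_near_rank_one Y hYpos
  have hΔ : 2 * (p + 1) * altNorm (p + 1) Y / altNorm p Y ≤ 2 * (p + 1) * σ ^ 32 := by
    rw [div_le_iff₀ hYpos]
    calc 2 * ((p : ℝ) + 1) * altNorm (p + 1) Y ≤ 2 * (p + 1) * σ ^ 39 := by gcongr
      _ = 2 * (p + 1) * σ ^ 32 * σ ^ 7 := by ring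
      _ ≤ _ := by gcongr
  replace hF := hF.trans hΔ
  have hσ1 : (p + 1) * σ ≤ 1 / 16 := by
    have h1 : (1 : ℝ) ≤ p * 2 ^ p := one_le_mul_of_one_le_of_one_le hpR h2p
    have h2 : 0 ≤ (p + 1) * σ := by positivity
    nlinarith
  have hσ2 : σ ≤ 1 := by nlinarith
  have hFϱ : ‖F‖ ≤ 2 * ϱ := by
    have h1 : 2 * (p + 1) * σ ^ 32 ≤ 1 := by
      calc 2 * (p + 1) * σ ^ 32 = 2 * ((p + 1) * σ) * σ ^ 31 := by ring
        _ ≤ 2 * (1 / 16) * 1 := by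
          gcongr
          exact pow_le_one₀ hσ.le hσ2
        _ ≤ 1 := by norm_num
    have h2 := norm_sub_norm_le F Y
    rw [norm_sub_rev] at h2
    linarith
  have hδ : ‖altPullback p Y - φ.smulRight μ‖ ≤ σ ^ 30 / 8 := by
    rw [← hFr]
    refine (norm_altPullback_sub_le p Y F (R := 2 * ϱ) (by linarith) hFϱ).trans ?_
    have h1 : (2 * ϱ) ^ (p - 1) ≤ 2 ^ p * ϱ ^ p := by
      rw [← mul_pow]
      exact pow_le_pow_right₀ (by linarith) (Nat.sub_le _ _)
    calc p * (2 * ϱ) ^ (p - 1) * ‖Y - F‖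
        ≤ p * (2 ^ p * ϱ ^ p) * (2 * (p + 1) * σ ^ 32) := by gcongr
      _ = 16 * p * (p + 1) * 2 ^ p * σ * (ϱ ^ p * σ) * σ ^ 30 / 8 := by ring
      _ ≤ 1 * 1 * σ ^ 30 / 8 := by
        rw [hσϱ]
        gcongr
      _ = _ := by ring
  have hδY : σ ^ 30 / 8 ≤ ‖altPullback p Y‖ := by
    have h1 : σ ^ 30 ≤ σ ^ 7 := pow_le_pow_of_le_one hσ.le hσ2 (by norm_num)
    have h2 : 0 ≤ σ ^ 30 := by positivity
    change _ ≤ altNorm p Y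
    linarith
  obtain ⟨h1, h2⟩ := norm_mul_mul_of_near_rank_one (altPullback p Z) (altPullback p Y)
    (altPullback p X) φ μ hδ hδY
  rw [← altPullback_mul, ← altPullback_mul, ← altPullback_mul] at h1 h2
  change altNorm p (X * (Y * Z)) * altNorm p Y ≤ altNorm p (Y * Z) * altNorm p (X * Y) +
    8 * (σ ^ 30 / 8) * (altNorm p Z * altNorm p Y * altNorm p X) at h1
  change altNorm p (Y * Z) * altNorm p (X * Y) ≤ altNorm p (X * (Y * Z)) * altNorm p Y +
    8 * (σ ^ 30 / 8) * (altNorm p Z * altNorm p Y * altNorm p X) at h2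
  rw [mul_assoc X]
  constructor <;> linarith

theorem exists_fin_colouring {X V : Type*} [NormedAddCommGroup V] (f : X → V) {S : Set X}
    {K : Set V} (hK : IsCompact K) (hS : f '' S ⊆ K) (hne : S.Nonempty) {η : ℝ} (hη : 0 < η) :
    ∃ (q : ℕ) (col : X → Fin q), ∀ b ∈ S, ∀ b' ∈ S, col b = col b' → ‖f b' - f b‖ ≤ η := by
  obtain ⟨t, -, htfin, ht⟩ := exists_finite_net hK hS (half_pos hη)
  have := htfin.fintype
  have hnet : ∀ b, ∃ y : t, b ∈ S → ‖f b - y‖ < η / 2 := by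
    have hb : ∀ b ∈ S, ∃ y : t, ‖f b - y‖ < η / 2 := by
      intro b hb
      obtain ⟨y, hy, h⟩ := ht _ (Set.mem_image_of_mem _ hb)
      exact ⟨⟨y, hy⟩, h⟩
    intro b
    by_cases h : b ∈ S
    · exact (hb b h).imp fun _ h _ => h
    · obtain ⟨b₀, h₀⟩ := hne
      exact (hb b₀ h₀).imp fun _ _ h' => absurd h' h
  choose g hg using hnet
  refine ⟨Fintype.card t, fun b => Fintype.equivFin t (g b), fun b hb b' hb' h => ?_⟩
  have hgg : g b = g b' := (Fintype.equivFin t).injective h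
  have h2 := hg b hb
  rw [hgg, norm_sub_rev] at h2
  have h3 := norm_add_le (f b' - g b') (g b' - f b)
  rw [sub_add_sub_cancel] at h3
  linarith [hg b' hb']

theorem norm_mul_le_norm_mul_add {R : Type*} [NormedRing R] (x y z : R) :
    ‖y * z‖ ≤ ‖x * z‖ + ‖y - x‖ * ‖z‖ := by
  calc ‖y * z‖ = ‖x * z + (y - x) * z‖ := by rw [sub_mul, add_sub_cancel]
    _ ≤ _ := (norm_add_le _ _).trans (by gcongr; exact norm_mul_le _ _)

/-- A precompact set of operators has a finite colouring in which operators of equal colour act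
almost equally on `p`-forms. -/
theorem exists_colouring (p : ℕ) {S K : Set (E →L[ℝ] E)} (hK : IsCompact K) (hS : S ⊆ K)
    (hne : S.Nonempty) {η : ℝ} (hη : 0 < η) :
    ∃ (q : ℕ) (col : (E →L[ℝ] E) → Fin q), ∀ b ∈ S, ∀ b' ∈ S, col b = col b' →
      ∀ P, altNorm p (P * b') ≤ altNorm p (P * b) + η * altNorm p P := by
  obtain ⟨q, col, hcol⟩ := exists_fin_colouring (altPullback p) (K := altPullback p '' K)
    (hK.image (continuous_altPullback p)) (Set.image_mono hS) hne hη
  refine ⟨q, col, fun b hb b' hb' h P => ?_⟩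
  exact (norm_mul_le_norm_mul_add (altPullback p b) (altPullback p b') (altPullback p P)).trans
    (add_le_add_right (mul_le_mul_of_nonneg_right (hcol b hb b' hb' h) (altNorm_nonneg p P)) _)

end Core

section Main

variable {E : Type*} [NormedAddCommGroup E] [NormedSpace ℝ E] {A : Set (E →L[ℝ] E)}

theorem exists_pow_mul_le_one (k l : ℕ) {κ t : ℝ} (hκ1 : κ < 1) (ht0 : 0 < t) (ht1 : t < 1) :
    ∃ x > 1, x ^ k * κ ≤ 1 ∧ x ^ l * t ≤ 1 := by
  set c := max κ t
  have hc0 : 0 < c := ht0.trans_le (le_max_right _ _)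
  have hc1 : c < 1 := max_lt hκ1 ht1
  have hn : (0 : ℝ) < (k + l + 1 : ℕ) := by positivity
  set x := c⁻¹ ^ (1 / ((k + l + 1 : ℕ) : ℝ)) with hx
  have hx1 : 1 < x := Real.one_lt_rpow ((one_lt_inv₀ hc0).2 hc1) (by positivity)
  have hxk : x ^ (k + l + 1) * c = 1 := by
    rw [hx, ← Real.rpow_natCast, ← Real.rpow_mul (by positivity), one_div_mul_cancel hn.ne',
      Real.rpow_one, inv_mul_cancel₀ hc0.ne']
  have hle : ∀ i ≤ k + l + 1, ∀ y ≤ c, x ^ i * y ≤ 1 := fun i hi y hy => by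
    have h1 : x ^ i ≤ x ^ (k + l + 1) := pow_le_pow_right₀ hx1.le hi
    calc x ^ i * y ≤ x ^ i * c := by gcongr
      _ ≤ x ^ (k + l + 1) * c := by gcongr
      _ = 1 := hxk
  exact ⟨x, hx1, hle _ (by omega) _ (le_max_left _ _), hle _ (by omega) _ (le_max_right _ _)⟩

/-- A normalized version of the Berger–Wang formula. -/
theorem exists_prods_pow_ge (hne : A.Nonempty) (hA : IsCompact (closure A))
    (hlow : ∀ m ≥ 1, ∀ c < 1, ∃ P ∈ prods A m, c < ‖P‖)
    (hup : ∀ x > 1, ∃ n₀, ∀ n ≥ n₀, ∀ P ∈ prods A n, ‖P‖ ≤ x ^ n)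
    (hnet : ∃ m ≥ 1, ∀ P ∈ prods A m, ∃ S : Finset E,
      P '' Metric.closedBall 0 1 ⊆ ⋃ y ∈ S, Metric.ball y (1 / 8))
    {t : ℝ} (ht0 : 0 < t) (ht1 : t < 1) :
    ∃ n ≥ 1, ∃ P ∈ prods A n, ∀ m ≥ 1, t ^ (n * m) ≤ ‖P ^ m‖ := by
  obtain ⟨p, hp, hplow, m₀, hm₀, κ, hκ1, hκ⟩ := exists_critical_dimension hA hlow hnet
  have hκ0 : 0 ≤ κ := by
    obtain ⟨P, hP⟩ := prods_nonempty hne m₀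
    exact (altNorm_nonneg _ P).trans (hκ P hP)
  obtain ⟨x, hx1, hxκ, hxt⟩ := exists_pow_mul_le_one (39 * p * m₀) 18 hκ1 ht0 ht1
  have hx0 : 0 < x := zero_lt_one.trans hx1
  obtain ⟨n₀, hn₀⟩ := hup x hx1
  obtain ⟨u₁, hu₁⟩ := pow_unbounded_of_one_lt (max 2 (16 * p * (p + 1) * 2 ^ p : ℝ)) hx1
  set u := u₁ + n₀ + 1 with hu
  set M := m₀ * u with hM
  have huM : u ≤ M := Nat.le_mul_of_pos_left _ hm₀
  have hMpM : M ≤ p * M := Nat.le_mul_of_pos_left _ hp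
  set s := (x ^ (p * M))⁻¹ with hsdef
  have hs : 0 < s := by positivity
  have hbig : max 2 (16 * p * (p + 1) * 2 ^ p : ℝ) ≤ x ^ (p * M) :=
    hu₁.le.trans (pow_le_pow_right₀ hx1.le (by omega))
  have hs2 : s ≤ 1 / 2 := by
    rw [one_div]
    exact inv_anti₀ (by norm_num) ((le_max_left _ _).trans hbig)
  have hsmall : 16 * p * (p + 1) * 2 ^ p * s ≤ 1 := by
    rw [hsdef, ← div_eq_mul_inv, div_le_one (by positivity)]
    exact (le_max_right _ _).trans hbig
  obtain ⟨Kc, hKc, hsub⟩ := exists_isCompact_prods_subset hA M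
  obtain ⟨q, col, hcol⟩ := exists_colouring p hKc hsub (prods_nonempty hne M)
    (by positivity : 0 < s ^ 7 / 4)
  have hS : ∀ b ∈ prods A M, altNorm p b ≤ s⁻¹ := by
    intro b hb
    refine (altNorm_le_pow p b).trans ?_
    rw [hsdef, inv_inv, mul_comm p, pow_mul]
    exact pow_le_pow_left₀ (norm_nonneg _) (hn₀ M (by omega) b hb) p
  have hlong : ∀ K ≥ 1, ∃ b : ℕ → E →L[ℝ] E, (∀ i, b i ∈ prods A M) ∧
      s ≤ altNorm p (wordProd b 0 K) := by
    intro K hK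
    obtain ⟨P, hP, hPn⟩ := hplow (M * K) (Nat.mul_pos (by omega) hK)
    obtain ⟨a, ha, rfl⟩ := exists_wordProd_of_mem_prods hne hP
    refine ⟨fun i => wordProd a (M * i) M, fun i => wordProd_mem_prods' ha _ _, ?_⟩
    rw [wordProd_wordProd]
    exact hs2.trans hPn.le
  have hdim : ∀ n, ∀ Y ∈ prods A (M * n), altNorm (p + 1) Y ≤ (s ^ n) ^ 39 := by
    intro n Y hY
    rw [hM, mul_assoc] at hY
    refine (apply_le_pow_of_mem_prods hne (altNorm (p + 1)) (altNorm_nonneg _) (altNorm_one_le _)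
      (altNorm_mul_le _) hκ hY).trans ?_
    have h1 : (x ^ (39 * p * m₀) * κ) ^ (u * n) ≤ 1 := pow_le_one₀ (by positivity) hxκ
    rw [mul_pow] at h1
    have h2 : (s ^ n) ^ 39 = ((x ^ (39 * p * m₀)) ^ (u * n))⁻¹ := by
      rw [hsdef, inv_pow, inv_pow, ← pow_mul, ← pow_mul, ← pow_mul, hM]
      congr 2
      ring
    rw [h2, ← one_div, le_div_iff₀ (by positivity), mul_comm]
    exact h1
  have hT : ∀ (b : ℕ → E →L[ℝ] E) (j n : ℕ), (∀ i, b i ∈ prods A M) → 1 ≤ n →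
      s ^ (7 * n) ≤ altNorm p (wordProd b j n) → ∀ X Z,
      (altNorm p (X * wordProd b j n * Z) * altNorm p (wordProd b j n) ≤
        altNorm p (X * wordProd b j n) * altNorm p (wordProd b j n * Z) +
          s ^ (30 * n) * (altNorm p X * altNorm p (wordProd b j n) * altNorm p Z)) ∧
      altNorm p (X * wordProd b j n) * altNorm p (wordProd b j n * Z) ≤
        altNorm p (X * wordProd b j n * Z) * altNorm p (wordProd b j n) +
          s ^ (30 * n) * (altNorm p X * altNorm p (wordProd b j n) * altNorm p Z) := by
    intro b j n hb hn hY X Z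
    have hmem := wordProd_mem_prods hb j n
    have hσϱ : (x ^ (M * n)) ^ p * s ^ n = 1 := by
      rw [hsdef, ← pow_mul, inv_pow, ← pow_mul, show p * M * n = M * n * p by ring]
      exact mul_inv_cancel₀ (by positivity)
    have hsn : s ^ n ≤ s := pow_le_of_le_one hs.le (by linarith) (by omega)
    have hest := altNorm_mul_mul_estimate hp (wordProd b j n) (pow_pos hs n)
      (one_le_pow₀ hx1.le) hσϱ (hn₀ _ (by nlinarith) _ hmem) (by rwa [← pow_mul, mul_comm n])
      (hdim n _ hmem) ((mul_le_mul_of_nonneg_left hsn (by positivity)).trans hsmall) X Z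
    rwa [← pow_mul, mul_comm n] at hest
  obtain ⟨b, j, n, hb, hn, hpow⟩ := exists_word_pow_ge (M := E →L[ℝ] E) (altNorm p)
    (altNorm_nonneg p) (altNorm_one_le p) (altNorm_mul_le p) hs hs2 (prods A M) hS hlong q col hcol hT
  refine ⟨M * n, Nat.mul_pos (by omega) hn, _, wordProd_mem_prods hb j n, fun m hm => ?_⟩
  have h1 := (hpow m hm).trans (altNorm_le_pow p _)
  have h2 : s ^ (18 * n * m) = ((x ^ 18)⁻¹ ^ (M * n * m)) ^ p := by
    rw [hsdef, inv_pow, inv_pow, inv_pow, ← pow_mul, ← pow_mul, ← pow_mul]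
    congr 2
    ring
  rw [h2] at h1
  refine le_trans (pow_le_pow_left₀ ht0.le ?_ _)
    (le_of_pow_le_pow_left₀ (by omega) (norm_nonneg _) h1)
  rw [← one_div, le_div_iff₀ (by positivity), mul_comm]
  exact hxt

end Main

section Scaling

variable {R : Type*} [NormedRing R] [NormedAlgebra ℝ R] {A : Set R}

theorem smul_mem_prods_image {n : ℕ} {P : R} (hP : P ∈ prods A n) (c : ℝ) :
    c ^ n • P ∈ prods ((fun x => c • x) '' A) n := by
  induction n generalizing P with
  | zero =>
    rw [mem_prods_zero] at hP ⊢
    rw [hP, pow_zero, one_smul]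
  | succ n ih =>
    obtain ⟨x, hx, Q, hQ, rfl⟩ := mem_prods_succ.1 hP
    refine mem_prods_succ.2 ⟨c • x, ⟨x, hx, rfl⟩, _, ih hQ, ?_⟩
    rw [smul_mul_smul_comm, pow_succ']

theorem exists_eq_smul_of_mem_prods_image {n : ℕ} {Q : R} {c : ℝ}
    (hQ : Q ∈ prods ((fun x => c • x) '' A) n) : ∃ P ∈ prods A n, Q = c ^ n • P := by
  induction n generalizing Q with
  | zero => exact ⟨Q, mem_prods_zero.2 (mem_prods_zero.1 hQ), by rw [pow_zero, one_smul]⟩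
  | succ n ih =>
    obtain ⟨_, ⟨x, hx, rfl⟩, Q', hQ', rfl⟩ := mem_prods_succ.1 hQ
    obtain ⟨P, hP, rfl⟩ := ih hQ'
    exact ⟨x * P, mem_prods_succ.2 ⟨x, hx, P, hP, rfl⟩, by rw [smul_mul_smul_comm, pow_succ']⟩

end Scaling

section Radii

theorem rpow_one_div_le_iff {x y : ℝ} (hx : 0 ≤ x) (hy : 0 ≤ y) {n : ℕ} (hn : n ≠ 0) :
    x ^ (1 / (n : ℝ)) ≤ y ↔ x ≤ y ^ n := by
  rw [one_div, Real.rpow_inv_le_iff_of_pos hx hy (by positivity), Real.rpow_natCast]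

theorem le_rpow_one_div_iff {x y : ℝ} (hx : 0 ≤ x) (hy : 0 ≤ y) {n : ℕ} (hn : n ≠ 0) :
    y ≤ x ^ (1 / (n : ℝ)) ↔ y ^ n ≤ x := by
  rw [one_div, Real.le_rpow_inv_iff_of_pos hy hx (by positivity), Real.rpow_natCast]

section NormedRing

variable {R : Type*} [NormedRing R] {A : Set R}

theorem norm_pow_rpow_le (P : R) {k : ℕ} (hk : k ≠ 0) : ‖P ^ k‖ ^ (1 / (k : ℝ)) ≤ ‖P‖ :=
  (rpow_one_div_le_iff (norm_nonneg _) (norm_nonneg _) hk).2 (norm_pow_le' P (by omega))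

theorem isBoundedUnder_norm_pow_rpow (P : R) :
    IsBoundedUnder (· ≤ ·) atTop fun k : ℕ => ‖P ^ k‖ ^ (1 / (k : ℝ)) :=
  isBoundedUnder_of_eventually_le (a := ‖P‖)
    ((eventually_ne_atTop 0).mono fun _ hk => norm_pow_rpow_le P hk)

theorem le_specRad (P : R) {c : ℝ} (h : ∀ k : ℕ, 1 ≤ k → c ≤ ‖P ^ k‖ ^ (1 / (k : ℝ))) :
    c ≤ specRad P :=
  le_limsup_of_frequently_le ((eventually_ge_atTop 1).mono h).frequently
    (isBoundedUnder_norm_pow_rpow P)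

theorem specRad_nonneg (P : R) : 0 ≤ specRad P :=
  le_specRad P fun _ _ => by positivity

theorem specRad_le_norm (P : R) : specRad P ≤ ‖P‖ :=
  limsup_le_of_le (isCoboundedUnder_le_of_le atTop (x := 0) fun _ => by positivity)
    ((eventually_ne_atTop 0).mono fun _ hk => norm_pow_rpow_le P hk)

theorem bddAbove_rpow_image_prods (hA : IsCompact (closure A)) {f : R → ℝ} (hf0 : ∀ P, 0 ≤ f P)
    (hf : ∀ P, f P ≤ ‖P‖) (n : ℕ) :
    BddAbove ((fun P => f P ^ (1 / (n : ℝ))) '' prods A n) := by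
  obtain ⟨K, hK, hsub⟩ := exists_isCompact_prods_subset hA n
  obtain ⟨C, hC⟩ := hK.isBounded.exists_norm_le
  refine ⟨C ^ (1 / (n : ℝ)), ?_⟩
  rintro _ ⟨P, hP, rfl⟩
  exact Real.rpow_le_rpow (hf0 P) ((hf P).trans (hC P (hsub hP))) (by positivity)

theorem sSup_rpow_image_nonneg {f : R → ℝ} (hf0 : ∀ P, 0 ≤ f P) (n : ℕ) :
    0 ≤ sSup ((fun P => f P ^ (1 / (n : ℝ))) '' prods A n) := by
  refine Real.sSup_nonneg ?_
  rintro _ ⟨P, -, rfl⟩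
  exact Real.rpow_nonneg (hf0 P) _

theorem sSup_rpow_image_le (hne : A.Nonempty) (hA : IsCompact (closure A)) {f : R → ℝ}
    (hf0 : ∀ P, 0 ≤ f P) (hf : ∀ P, f P ≤ ‖P‖) (n : ℕ) :
    sSup ((fun P => f P ^ (1 / (n : ℝ))) '' prods A n) ≤
      sSup ((fun P => ‖P‖ ^ (1 / (n : ℝ))) '' prods A n) := by
  refine csSup_le ((prods_nonempty hne n).image _) ?_
  rintro _ ⟨P, hP, rfl⟩
  exact (Real.rpow_le_rpow (hf0 P) (hf P) (by positivity)).trans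
    (le_csSup (bddAbove_rpow_image_prods hA norm_nonneg (fun _ => le_rfl) n) ⟨P, hP, rfl⟩)

/-- Upper bounds on the products given by the radius of a nonnegative functional. -/
theorem eventually_le_pow (hA : IsCompact (closure A)) {f : R → ℝ} (hf0 : ∀ P, 0 ≤ f P)
    (hf : ∀ P, f P ≤ ‖P‖) {ρ d : ℝ} (hd0 : 0 ≤ d) (hρd : ρ < d)
    (h : Tendsto (fun n : ℕ => sSup ((fun P => f P ^ (1 / (n : ℝ))) '' prods A n)) atTop (𝓝 ρ)) :
    ∀ᶠ n : ℕ in atTop, ∀ P ∈ prods A n, f P ≤ d ^ n := by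
  filter_upwards [h.eventually_lt_const hρd, eventually_ne_atTop 0] with n hn hn0 P hP
  exact (rpow_one_div_le_iff (hf0 P) hd0 hn0).1
    ((le_csSup (bddAbove_rpow_image_prods hA hf0 hf n) ⟨P, hP, rfl⟩).trans hn.le)

/-- The norm of the products of length `m` is not much smaller than the `m`-th power of the joint
spectral radius. -/
theorem exists_lt_norm_of_tendsto (hne : A.Nonempty) (h1 : ‖(1 : R)‖ ≤ 1) {ρ : ℝ} (hρ : 0 < ρ)
    (h : Tendsto (fun n : ℕ => sSup ((fun P => ‖P‖ ^ (1 / (n : ℝ))) '' prods A n)) atTop (𝓝 ρ))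
    {m : ℕ} (hm : 1 ≤ m) {c : ℝ} (hc : c < 1) : ∃ P ∈ prods A m, c * ρ ^ m < ‖P‖ := by
  by_contra! hcon
  have hm0 : m ≠ 0 := by omega
  have hc0 : 0 ≤ c * ρ ^ m := by
    obtain ⟨P, hP⟩ := prods_nonempty hne m
    exact (norm_nonneg P).trans (hcon P hP)
  set d := (c * ρ ^ m) ^ (1 / (m : ℝ)) with hd
  have hd0 : 0 ≤ d := Real.rpow_nonneg hc0 _
  have hdm : c * ρ ^ m ≤ d ^ m := (rpow_one_div_le_iff hc0 hd0 hm0).1 le_rfl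
  have hle : ρ ≤ d := by
    refine le_of_tendsto (h.comp (tendsto_id.const_mul_atTop' hm)) ?_
    filter_upwards [eventually_ge_atTop 1] with k hk
    refine csSup_le ((prods_nonempty hne _).image _) ?_
    rintro _ ⟨P, hP, rfl⟩
    refine (rpow_one_div_le_iff (norm_nonneg P) hd0 (Nat.mul_pos hm hk).ne').2 ?_
    change ‖P‖ ≤ d ^ (m * k)
    rw [pow_mul]
    exact apply_le_pow_of_mem_prods hne norm norm_nonneg h1 norm_mul_le
      (fun Q hQ => (hcon Q hQ).trans hdm) hP
  have h2 : ρ ^ m ≤ c * ρ ^ m := (le_rpow_one_div_iff hc0 hρ.le hm0).1 hle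
  nlinarith [pow_pos hρ m]

end NormedRing

variable {E : Type*} [NormedAddCommGroup E] [NormedSpace ℝ E]

theorem hmnc_nonneg (L : E →L[ℝ] E) : 0 ≤ hmnc L :=
  Real.sInf_nonneg fun _ h => h.1.le

theorem hmnc_set_of_norm_lt (L : E →L[ℝ] E) {ε : ℝ} (h : ‖L‖ < ε) :
    ε ∈ {ε : ℝ | 0 < ε ∧ ∃ S : Finset E,
      L '' Metric.closedBall 0 1 ⊆ ⋃ y ∈ S, Metric.ball y ε} := by
  refine ⟨(norm_nonneg L).trans_lt h, {0}, ?_⟩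
  rintro _ ⟨x, hx, rfl⟩
  simpa using (L.unit_le_opNorm x (mem_closedBall_zero_iff.1 hx)).trans_lt h

theorem hmnc_le_norm (L : E →L[ℝ] E) : hmnc L ≤ ‖L‖ :=
  le_of_forall_gt_imp_ge_of_dense fun _ h =>
    csInf_le ⟨0, fun _ h => h.1.le⟩ (hmnc_set_of_norm_lt L h)

theorem exists_net_of_hmnc_lt (L : E →L[ℝ] E) {ε c : ℝ} (hc : 0 < c) (h : hmnc L < ε) :
    ∃ S : Finset E, (c • L) '' Metric.closedBall 0 1 ⊆ ⋃ y ∈ S, Metric.ball y (c * ε) := by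
  classical
  obtain ⟨δ, ⟨-, S, hS⟩, hδ⟩ :=
    exists_lt_of_csInf_lt ⟨_, hmnc_set_of_norm_lt L (lt_add_one ‖L‖)⟩ h
  refine ⟨S.image fun y => c • y, ?_⟩
  rintro _ ⟨x, hx, rfl⟩
  obtain ⟨y, hy, hxy⟩ := Set.mem_iUnion₂.1 (hS (Set.mem_image_of_mem L hx))
  refine Set.mem_iUnion₂.2 ⟨c • y, Finset.mem_image_of_mem _ hy, ?_⟩
  rw [mem_ball_iff_norm] at hxy ⊢
  rw [smul_apply, ← smul_sub, norm_smul, Real.norm_of_nonneg hc.le]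
  exact mul_lt_mul_of_pos_left (hxy.trans hδ) hc

/-- If the essential radius is smaller than the joint spectral radius, then some product has
spectral radius close to the maximal one. -/
theorem exists_prods_norm_pow_ge (A : Set (E →L[ℝ] E)) (hne : A.Nonempty)
    (hpc : IsCompact (closure A)) {ρ ρχ : ℝ}
    (hr : Tendsto (fun n : ℕ => sSup ((fun P => ‖P‖ ^ (1 / (n : ℝ))) '' prods A n)) atTop (𝓝 ρ))
    (hχ : Tendsto (fun n : ℕ => sSup ((fun P => hmnc P ^ (1 / (n : ℝ))) '' prods A n))
      atTop (𝓝 ρχ)) (hχ0 : 0 ≤ ρχ) (hlt : ρχ < ρ) {t : ℝ} (ht0 : 0 < t) (ht1 : t < 1) :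
    ∃ n ≥ 1, ∃ P ∈ prods A n, ∀ m ≥ 1, (t * ρ) ^ (n * m) ≤ ‖P ^ m‖ := by
  have hρ : 0 < ρ := hχ0.trans_lt hlt
  have hscale : ∀ (n : ℕ) (P : E →L[ℝ] E), ‖ρ⁻¹ ^ n • P‖ = ‖P‖ / ρ ^ n := by
    intro n P
    rw [norm_smul, Real.norm_of_nonneg (by positivity), inv_pow, div_eq_inv_mul]
  have hA₁ : IsCompact (closure ((fun x : E →L[ℝ] E => ρ⁻¹ • x) '' A)) :=
    (hpc.image (continuous_const_smul ρ⁻¹)).closure_of_subset (Set.image_mono subset_closure)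
  suffices H : ∃ n ≥ 1, ∃ Q ∈ prods ((fun x : E →L[ℝ] E => ρ⁻¹ • x) '' A) n,
      ∀ m ≥ 1, t ^ (n * m) ≤ ‖Q ^ m‖ by
    obtain ⟨n, hn, Q, hQ, h⟩ := H
    obtain ⟨P, hP, rfl⟩ := exists_eq_smul_of_mem_prods_image hQ
    refine ⟨n, hn, P, hP, fun m hm => ?_⟩
    have h1 := h m hm
    rw [smul_pow, ← pow_mul, hscale, le_div_iff₀ (by positivity), ← mul_pow] at h1
    exact h1
  refine exists_prods_pow_ge (hne.image _) hA₁ ?_ ?_ ?_ ht0 ht1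
  · intro m hm c hc
    obtain ⟨P, hP, h⟩ := exists_lt_norm_of_tendsto hne ContinuousLinearMap.norm_id_le hρ hr hm hc
    refine ⟨_, smul_mem_prods_image hP _, ?_⟩
    rwa [hscale, lt_div_iff₀ (by positivity)]
  · intro x hx
    obtain ⟨n₀, hn₀⟩ := eventually_atTop.1 (eventually_le_pow (d := x * ρ) hpc norm_nonneg
      (fun _ => le_rfl) (by positivity) (by nlinarith) hr)
    refine ⟨n₀, fun n hn Q hQ => ?_⟩
    obtain ⟨P, hP, rfl⟩ := exists_eq_smul_of_mem_prods_image hQ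
    rw [hscale, div_le_iff₀ (by positivity), ← mul_pow]
    exact hn₀ n hn P hP
  · obtain ⟨d, hd1, hd2⟩ := exists_between hlt
    have hd0 : 0 ≤ d := hχ0.trans hd1.le
    have hlim : Tendsto (fun n : ℕ => (d / ρ) ^ n) atTop (𝓝 0) :=
      tendsto_pow_atTop_nhds_zero_of_lt_one (by positivity) ((div_lt_one hρ).2 hd2)
    obtain ⟨m, h1, h2, hm⟩ := ((eventually_le_pow hpc hmnc_nonneg hmnc_le_norm hd0 hd1 hχ).and
      ((hlim.eventually_lt_const (by norm_num : (0 : ℝ) < 1 / 8)).and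
        (eventually_ge_atTop 1))).exists
    refine ⟨m, hm, fun Q hQ => ?_⟩
    obtain ⟨P, hP, rfl⟩ := exists_eq_smul_of_mem_prods_image hQ
    have h3 : hmnc P < ρ ^ m * (1 / 8) := by
      rw [div_pow, div_lt_iff₀ (by positivity)] at h2
      linarith [h1 P hP]
    have h4 := exists_net_of_hmnc_lt P (c := ρ⁻¹ ^ m) (by positivity) h3
    rwa [inv_pow, inv_mul_cancel_left₀ (by positivity), ← inv_pow] at h4

end Radii

/-- **The generalized Berger–Wang formula** (Shulman–Turovskiĭ; here by ergodic theory):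
for a nonempty precompact set `A` of bounded operators on a Banach space `𝕏`,
`ρ̂(A) = max (ρ_χ(A)) (ρ_r(A))`.  The limits defining `ρ̂(A)` and `ρ_χ(A)` exist by
submultiplicativity and are given here as hypotheses `hr`, `hχ`. -/
theorem generalized_berger_wang (A : Set (𝕏 →L[ℝ] 𝕏)) (hne : A.Nonempty)
    (hpc : IsCompact (closure A)) (ρhat ρχ : ℝ)
    (hr : Tendsto (fun n : ℕ => sSup ((fun P => ‖P‖ ^ (1 / (n : ℝ))) '' prods A n))
      atTop (nhds ρhat))
    (hχ : Tendsto (fun n : ℕ => sSup ((fun P => hmnc P ^ (1 / (n : ℝ))) '' prods A n))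
      atTop (nhds ρχ)) :
    ρhat = max ρχ
      (Filter.atTop.limsup fun n : ℕ =>
        sSup ((fun P => specRad P ^ (1 / (n : ℝ))) '' prods A n)) := by
  have hle := sSup_rpow_image_le hne hpc specRad_nonneg specRad_le_norm
  have hbdd : IsBoundedUnder (· ≤ ·) atTop fun n : ℕ =>
      sSup ((fun P => specRad P ^ (1 / (n : ℝ))) '' prods A n) :=
    hr.isBoundedUnder_le.mono_le (Eventually.of_forall hle)
  refine le_antisymm ?_ (max_le ?_ ?_)
  · rcases le_or_gt ρhat ρχ with h | h
    · exact le_max_of_le_left h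
    refine le_max_of_le_right ?_
    have hχ0 : 0 ≤ ρχ :=
      ge_of_tendsto hχ (Eventually.of_forall (sSup_rpow_image_nonneg hmnc_nonneg))
    have hρ : 0 < ρhat := hχ0.trans_lt h
    refine le_of_forall_lt_imp_le_of_dense fun c hc => ?_
    set t := max (c / ρhat) (1 / 2)
    have ht0 : 0 < t := lt_max_of_lt_right (by norm_num)
    have ht1 : t < 1 := max_lt ((div_lt_one hρ).2 hc) (by norm_num)
    have hct : c ≤ t * ρhat := (div_le_iff₀ hρ).1 (le_max_left _ _)
    obtain ⟨n, hn, P, hP, hpow⟩ := exists_prods_norm_pow_ge A hne hpc hr hχ hχ0 h ht0 ht1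
    have hr0 : 0 ≤ t * ρhat := by positivity
    refine hct.trans (le_limsup_of_frequently_le ?_ hbdd)
    refine frequently_atTop.2 fun k => ⟨n * (k + 1), by nlinarith, ?_⟩
    refine le_trans ?_ (le_csSup (bddAbove_rpow_image_prods hpc specRad_nonneg specRad_le_norm _)
      ⟨P ^ (k + 1), pow_mem_prods hP (k + 1), rfl⟩)
    refine (le_rpow_one_div_iff (specRad_nonneg _) hr0 (by positivity)).2 ?_
    refine le_specRad _ fun i hi => ?_
    refine (le_rpow_one_div_iff (norm_nonneg _) (by positivity) (by omega)).2 ?_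
    rw [← pow_mul, ← pow_mul, mul_assoc]
    exact hpow _ (Nat.mul_pos k.succ_pos hi)
  · exact le_of_tendsto_of_tendsto' hχ hr (sSup_rpow_image_le hne hpc hmnc_nonneg hmnc_le_norm)
  · rw [← hr.limsup_eq]
    exact limsup_le_limsup (Eventually.of_forall hle)
      (isCoboundedUnder_le_of_le atTop fun n => sSup_rpow_image_nonneg specRad_nonneg n)
      hr.isBoundedUnder_le
end
end

section
/- Let T be a homeomorphism of a compact metric space X, μ a T-invariant Borel probability measure on X, 𝔛 a Banach space, and 𝒜 : X × ℕ → B(𝔛) a continuous linear cocycle over T such that 𝒜(x,n) is an injective operator for every (x,n) ∈ X × ℕ. Then for μ-almost-every x ∈ X the limit χ(x) := lim_{n→∞} (1/n) log ‖𝒜(x,n)‖_χ exists in ℝ ∪ {−∞}, the limit lim_{n→∞} (1/n) log ‖𝒜(x,n)‖_f exists, and these two limits are equal. -/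
open Filter Topology MeasureTheory

noncomputable section

variable {𝕏 : Type*} [NormedAddCommGroup 𝕏] [NormedSpace ℝ 𝕏] [CompleteSpace 𝕏]

/-- Logarithm with the convention `log 0 = -∞`. -/
def elog (x : ℝ) : EReal := if x = 0 then ⊥ else ((Real.log x : ℝ) : EReal)

section Covering

variable {E : Type*} [NormedAddCommGroup E] [NormedSpace ℝ E]

/-- The image of the closed unit ball under `L` is covered by at most `N` closed balls of
radius `r`. -/
def Covers (L : E →L[ℝ] E) (N : ℕ) (r : ℝ) : Prop :=
  ∃ S : Finset E, S.card ≤ N ∧ ∀ v, ‖v‖ ≤ 1 → ∃ y ∈ S, ‖L v - y‖ ≤ r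

/-- The unit ball contains `N` points whose images under `L` are `s`-separated. -/
def Packs (L : E →L[ℝ] E) (s : ℝ) (N : ℕ) : Prop :=
  ∃ x : Fin N → E, (∀ i, ‖x i‖ ≤ 1) ∧ Pairwise fun i j => s ≤ ‖L (x i - x j)‖

theorem Covers.mono {L : E →L[ℝ] E} {N N' : ℕ} {r r' : ℝ} (h : Covers L N r) (hN : N ≤ N')
    (hr : r ≤ r') : Covers L N' r' := by
  obtain ⟨S, hS, hc⟩ := h
  refine ⟨S, hS.trans hN, fun v hv => ?_⟩
  obtain ⟨y, hy, h⟩ := hc v hv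
  exact ⟨y, hy, h.trans hr⟩

theorem covers_one_of_norm_le {L : E →L[ℝ] E} {r : ℝ} (h : ‖L‖ ≤ r) : Covers L 1 r :=
  ⟨{0}, by simp, fun v hv => ⟨0, by simp, by
    simpa using (L.le_of_opNorm_le_of_le h hv)⟩⟩

theorem Covers.perturb {L L' : E →L[ℝ] E} {N : ℕ} {r δ : ℝ} (h : Covers L N r)
    (hd : ‖L' - L‖ ≤ δ) : Covers L' N (r + δ) := by
  obtain ⟨S, hS, hc⟩ := h
  refine ⟨S, hS, fun v hv => ?_⟩
  obtain ⟨y, hy, h⟩ := hc v hv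
  refine ⟨y, hy, ?_⟩
  have h1 : ‖(L' - L) v‖ ≤ δ := by simpa using (L' - L).le_of_opNorm_le_of_le hd hv
  calc ‖L' v - y‖ = ‖(L v - y) + (L' - L) v‖ := by congr 1; simp
    _ ≤ ‖L v - y‖ + ‖(L' - L) v‖ := norm_add_le _ _
    _ ≤ r + δ := add_le_add h h1

theorem Covers.mul {A B : E →L[ℝ] E} {M N : ℕ} {r s : ℝ} (hA : Covers A M r)
    (hB : Covers B N s) (hs : 0 < s) : Covers (A * B) (M * N) (r * s) := by
  classical
  obtain ⟨S, hS, hc⟩ := hA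
  obtain ⟨S', hS', hc'⟩ := hB
  refine ⟨(S ×ˢ S').image fun p => A p.2 + s • p.1, ?_, fun v hv => ?_⟩
  · refine Finset.card_image_le.trans ?_
    rw [Finset.card_product]
    exact Nat.mul_le_mul hS hS'
  · obtain ⟨y, hy, h⟩ := hc' v hv
    obtain ⟨z, hz, h'⟩ := hc (s⁻¹ • (B v - y)) (by
      rw [norm_smul, Real.norm_of_nonneg (by positivity), inv_mul_le_iff₀ hs]; simpa using h)
    refine ⟨A y + s • z, Finset.mem_image.2 ⟨(z, y), by simp [hz, hy], rfl⟩, ?_⟩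
    have : (A * B) v - (A y + s • z) = s • (A (s⁻¹ • (B v - y)) - z) := by
      simp only [map_smul, smul_sub, smul_inv_smul₀ hs.ne', map_sub, mul_apply_eq_comp]
      abel
    rw [this, norm_smul, Real.norm_of_nonneg hs.le, mul_comm]
    gcongr

theorem Covers.hmnc_le {L : E →L[ℝ] E} {N : ℕ} {r : ℝ} (h : Covers L N r) : hmnc L ≤ r := by
  obtain ⟨S, -, hc⟩ := h
  have hr : 0 ≤ r := by
    obtain ⟨y, -, h⟩ := hc 0 (by simp)
    exact (norm_nonneg _).trans h
  refine le_of_forall_pos_le_add fun δ hδ => ?_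
  refine csInf_le ⟨0, fun _ h => h.1.le⟩ ⟨by positivity, S, ?_⟩
  rintro _ ⟨v, hv, rfl⟩
  obtain ⟨y, hy, h⟩ := hc v (by simpa using hv)
  simp only [Set.mem_iUnion, Metric.mem_ball, dist_eq_norm]
  exact ⟨y, hy, by linarith⟩

theorem exists_covers_of_hmnc_lt {L : E →L[ℝ] E} {r : ℝ} (h : hmnc L < r) :
    ∃ N, Covers L N r := by
  have hne : {ε : ℝ | 0 < ε ∧ ∃ S : Finset E,
      L '' Metric.closedBall 0 1 ⊆ ⋃ y ∈ S, Metric.ball y ε}.Nonempty := by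
    refine ⟨‖L‖ + 1, by positivity, {0}, ?_⟩
    rintro _ ⟨v, hv, rfl⟩
    have := L.le_of_opNorm_le_of_le le_rfl (by simpa using hv : ‖v‖ ≤ 1)
    simp only [Finset.mem_singleton, Set.iUnion_iUnion_eq_left, mem_ball_zero_iff]
    linarith
  obtain ⟨ε, ⟨-, S, hS⟩, hε⟩ := exists_lt_of_csInf_lt hne h
  refine ⟨S.card, S, le_rfl, fun v hv => ?_⟩
  have := hS ⟨v, by simpa using hv, rfl⟩
  simp only [Set.mem_iUnion, Metric.mem_ball, dist_eq_norm] at this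
  obtain ⟨y, hy, h⟩ := this
  exact ⟨y, hy, by linarith⟩

theorem hmnc_le_add_norm_sub (L L' : E →L[ℝ] E) : hmnc L' ≤ hmnc L + ‖L' - L‖ := by
  refine le_of_forall_pos_le_add fun δ hδ => ?_
  obtain ⟨N, hN⟩ := exists_covers_of_hmnc_lt (lt_add_of_pos_right (hmnc L) hδ)
  linarith [(hN.perturb (le_refl ‖L' - L‖)).hmnc_le]

theorem continuous_hmnc : Continuous (hmnc : (E →L[ℝ] E) → ℝ) := by
  refine (LipschitzWith.of_le_add fun L L' => ?_).continuous
  simpa [dist_eq_norm] using hmnc_le_add_norm_sub L' L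

theorem hmnc_mul_le (A B : E →L[ℝ] E) : hmnc (A * B) ≤ hmnc A * ‖B‖ := by
  have key : ∀ δ > 0, hmnc (A * B) ≤ (hmnc A + δ) * (‖B‖ + δ) := fun δ hδ => by
    obtain ⟨N, hN⟩ := exists_covers_of_hmnc_lt (lt_add_of_pos_right (hmnc A) hδ)
    exact (hN.mul (covers_one_of_norm_le (by linarith : ‖B‖ ≤ ‖B‖ + δ))
      (by positivity)).hmnc_le
  have lim : Tendsto (fun δ : ℝ => (hmnc A + δ) * (‖B‖ + δ)) (𝓝[>] 0)
      (𝓝 ((hmnc A + 0) * (‖B‖ + 0))) :=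
    (Continuous.tendsto (by fun_prop) 0).mono_left nhdsWithin_le_nhds
  simp only [add_zero] at lim
  exact ge_of_tendsto lim (eventually_nhdsWithin_of_forall key)

theorem fdist_le_norm_sub (L K : E →L[ℝ] E)
    (hK : FiniteDimensional ℝ (LinearMap.range (K : E →ₗ[ℝ] E))) : fdist L ≤ ‖L - K‖ :=
  csInf_le ⟨0, by rintro _ ⟨K, -, rfl⟩; positivity⟩ ⟨K, hK, rfl⟩

theorem finiteDimensional_range_zero :
    FiniteDimensional ℝ (LinearMap.range ((0 : E →L[ℝ] E) : E →ₗ[ℝ] E)) := by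
  rw [ContinuousLinearMap.toLinearMap_zero, LinearMap.range_zero]
  infer_instance

theorem fdist_nonneg (L : E →L[ℝ] E) : 0 ≤ fdist L :=
  Real.sInf_nonneg (by rintro _ ⟨K, -, rfl⟩; positivity)

theorem fdist_le_norm (L : E →L[ℝ] E) : fdist L ≤ ‖L‖ := by
  simpa using fdist_le_norm_sub L 0 finiteDimensional_range_zero

theorem hmnc_le_fdist (L : E →L[ℝ] E) : hmnc L ≤ fdist L := by
  refine le_csInf ⟨_, 0, finiteDimensional_range_zero, rfl⟩ ?_
  rintro _ ⟨K, hK, rfl⟩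
  have hK0 : hmnc K ≤ 0 := by
    refine le_of_forall_pos_le_add fun δ hδ => ?_
    let R := LinearMap.range (K : E →ₗ[ℝ] E)
    have : FiniteDimensional ℝ R := hK
    have : ProperSpace R := FiniteDimensional.proper ℝ R
    obtain ⟨t, -, ht, hcov⟩ := Metric.finite_approx_of_totallyBounded
      (isCompact_closedBall (0 : R) ‖K‖).totallyBounded δ hδ
    classical
    refine Covers.hmnc_le (N := (ht.toFinset.image (fun y : R => (y : E))).card)
      ⟨ht.toFinset.image (fun y : R => (y : E)), le_rfl, fun v hv => ?_⟩
    have hv' : ‖K v‖ ≤ ‖K‖ := by simpa using K.le_of_opNorm_le_of_le le_rfl hv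
    have := hcov (show (⟨K v, ⟨v, rfl⟩⟩ : R) ∈ Metric.closedBall 0 ‖K‖ by
      simpa using hv')
    simp only [Set.mem_iUnion, Metric.mem_ball] at this
    obtain ⟨y, hy, h⟩ := this
    refine ⟨y, by simpa using hy, ?_⟩
    have h' := h.le
    rw [dist_eq_norm] at h'
    simpa using h'
  linarith [hmnc_le_add_norm_sub K L]

theorem Packs.le_of_covers {L : E →L[ℝ] E} {s r : ℝ} {M N : ℕ} (hp : Packs L s M)
    (hc : Covers L N r) (hsr : 2 * r < s) : M ≤ N := by
  obtain ⟨x, hx, hsep⟩ := hp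
  obtain ⟨S, hS, hc⟩ := hc
  choose y hy hyr using fun i => hc (x i) (hx i)
  classical
  have hinj : Function.Injective y := fun i j hij => by
    by_contra hne
    have h1 : s ≤ ‖L (x i - x j)‖ := hsep hne
    have : L (x i - x j) = (L (x i) - y i) - (L (x j) - y j) := by rw [map_sub, hij]; abel
    rw [this] at h1
    linarith [norm_sub_le (L (x i) - y i) (L (x j) - y j), hyr i, hyr j]
  calc M = (Finset.univ.image y).card := by
        rw [Finset.card_image_of_injective _ hinj]; simp
    _ ≤ S.card := Finset.card_le_card (by
        intro z hz
        obtain ⟨i, -, rfl⟩ := Finset.mem_image.1 hz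
        exact hy i)
    _ ≤ N := hS

/-- Deflating the operator by one dimension: a finite-rank perturbation `L'` of `L` from whose
separated sets one obtains separated sets of `L` with `m` times as many elements. -/
theorem exists_deflation {L : E →L[ℝ] E} {t : ℝ} (ht : 0 < t) (hL : t < ‖L‖) :
    ∃ K : E →L[ℝ] E, FiniteDimensional ℝ (LinearMap.range (K : E →ₗ[ℝ] E)) ∧
      ∀ (s : ℝ) (m N : ℕ), 0 < m → s * m ≤ t → Packs (L - K) s N → Packs L (s / 4) (N * m) := by
  obtain ⟨v, hv, hLv⟩ : ∃ v, ‖v‖ ≤ 1 ∧ t < ‖L v‖ := by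
    by_contra! h
    exact absurd (L.opNorm_le_of_unit_norm ht.le fun v hv => h v hv.le) (not_le.2 hL)
  obtain ⟨φ, hφ, hφv⟩ := exists_dual_vector ℝ (L v) (by linarith)
  set a := ‖L v‖ with ha
  have ha0 : 0 < a := ht.trans hLv
  have hφv : φ (L v) = a := by simpa using hφv
  let K : E →L[ℝ] E := (φ.comp L).smulRight (a⁻¹ • L v)
  refine ⟨K, ?_, ?_⟩
  · refine Submodule.finiteDimensional_of_le (S₂ := Submodule.span ℝ {L v}) ?_
    rintro _ ⟨w, rfl⟩
    exact Submodule.smul_mem _ _ (Submodule.smul_mem _ _ (Submodule.mem_span_singleton_self _))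
  · rintro s m N hm hsm ⟨x, hx, hsep⟩
    have hK : ∀ w, K w = φ (L w) • a⁻¹ • L v := fun w => rfl
    have hbound : ∀ w, ‖(L - K) w‖ ≤ 2 * ‖L w‖ := fun w => by
      have h1 : ‖K w‖ ≤ ‖L w‖ := by
        rw [hK, norm_smul, norm_smul, ← ha, Real.norm_of_nonneg (inv_nonneg.2 ha0.le),
          inv_mul_cancel₀ ha0.ne', mul_one]
        simpa [hφ] using φ.le_opNorm (L w)
      calc ‖(L - K) w‖ = ‖L w - K w‖ := rfl
        _ ≤ 2 * ‖L w‖ := by linarith [norm_sub_le (L w) (K w)]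
    have hKv : (L - K) v = 0 := by
      rw [sub_apply, hK, hφv, smul_inv_smul₀ ha0.ne', sub_self]
    have hm' : (0 : ℝ) < m := by exact_mod_cast hm
    let z : Fin N × Fin m → E := fun p => (1 / 2 : ℝ) • (x p.1 + ((p.2 : ℕ) / m : ℝ) • v)
    have hz : ∀ p, ‖z p‖ ≤ 1 := fun p => by
      have h2 : ((p.2 : ℕ) / m : ℝ) ≤ 1 := by
        rw [div_le_one hm']; exact_mod_cast p.2.2.le
      have h3 : ‖((p.2 : ℕ) / m : ℝ) • v‖ ≤ 1 := by
        rw [norm_smul, Real.norm_of_nonneg (by positivity)]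
        exact mul_le_one₀ h2 (norm_nonneg _) hv
      calc ‖z p‖ = 1 / 2 * ‖x p.1 + ((p.2 : ℕ) / m : ℝ) • v‖ := by
            rw [norm_smul, Real.norm_of_nonneg (by norm_num)]
        _ ≤ 1 := by linarith [norm_add_le (x p.1) (((p.2 : ℕ) / m : ℝ) • v), hx p.1]
    have hzsep : Pairwise fun p q => s / 4 ≤ ‖L (z p - z q)‖ := by
      rintro ⟨i, k⟩ ⟨j, l⟩ hne
      by_cases hij : i = j
      · subst hij
        have hkl : k ≠ l := fun h => hne (by rw [h])
        have h1 : (1 : ℝ) ≤ |((k : ℕ) : ℝ) - ((l : ℕ) : ℝ)| := by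
          have : ((k : ℕ) : ℤ) - ((l : ℕ) : ℤ) ≠ 0 := by
            intro h; apply hkl; ext; omega
          have := Int.one_le_abs this
          exact_mod_cast this
        have h2 : z (i, k) - z (i, l) =
            ((((k : ℕ) : ℝ) - ((l : ℕ) : ℝ)) * (2 * m : ℝ)⁻¹) • v := by
          simp only [z]
          rw [← smul_sub, add_sub_add_left_eq_sub, ← sub_smul, smul_smul]
          congr 1
          field_simp
        have h3 : s ≤ t / m := by rwa [le_div_iff₀ hm']
        have hsa : s / 2 ≤ (2 * m : ℝ)⁻¹ * a := by
          rw [inv_mul_eq_div, le_div_iff₀ (by positivity)]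
          linarith
        by_cases hs : s ≤ 0
        · linarith [norm_nonneg (L (z (i, k) - z (i, l)))]
        rw [h2, map_smul, norm_smul, norm_mul, Real.norm_eq_abs,
          Real.norm_of_nonneg (by positivity : (0 : ℝ) ≤ (2 * m : ℝ)⁻¹), ← ha, mul_assoc]
        have : 0 ≤ (2 * m : ℝ)⁻¹ * a := by positivity
        nlinarith
      · have h1 := hsep hij
        have h2 : (L - K) (z (i, k) - z (j, l)) = (1 / 2 : ℝ) • (L - K) (x i - x j) := by
          simp only [z, map_sub, map_smul, map_add, hKv, smul_zero, add_zero, smul_sub]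
        have h3 := hbound (z (i, k) - z (j, l))
        rw [h2, norm_smul, Real.norm_of_nonneg (by norm_num)] at h3
        linarith
    refine ⟨z ∘ finProdFinEquiv.symm, fun i => hz _, fun i j hij => ?_⟩
    exact hzsep (finProdFinEquiv.symm.injective.ne hij)

theorem fdist_le_fdist_sub (L K : E →L[ℝ] E)
    (hK : FiniteDimensional ℝ (LinearMap.range (K : E →ₗ[ℝ] E))) :
    fdist L ≤ fdist (L - K) := by
  refine le_csInf ⟨_, 0, finiteDimensional_range_zero, rfl⟩ ?_
  rintro _ ⟨K', hK', rfl⟩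
  rw [sub_sub]
  refine fdist_le_norm_sub L _ ?_
  refine Submodule.finiteDimensional_of_le
    (S₂ := LinearMap.range (K : E →ₗ[ℝ] E) ⊔ LinearMap.range (K' : E →ₗ[ℝ] E)) ?_
  rintro _ ⟨w, rfl⟩
  exact Submodule.add_mem_sup ⟨w, rfl⟩ ⟨w, rfl⟩

theorem packs_of_lt_fdist {t : ℝ} (ht : 0 < t) {m : ℕ} (hm : 0 < m) (k : ℕ)
    {L : E →L[ℝ] E} (hL : t < fdist L) : Packs L (t / m / 4 ^ k) (m ^ k) := by
  induction k generalizing L with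
  | zero =>
    refine ⟨fun _ => 0, by simp, fun i j hij => ?_⟩
    exact absurd (Fin.ext (by have := i.2; have := j.2; simp only [pow_zero] at *; omega)) hij
  | succ k ih =>
    obtain ⟨K, hK, hpack⟩ := exists_deflation ht (hL.trans_le (fdist_le_norm L))
    have hm' : (0 : ℝ) < m := by exact_mod_cast hm
    have := hpack _ m _ hm ?_ (ih (hL.trans_le (fdist_le_fdist_sub L K hK)))
    · rwa [div_div, ← pow_succ, ← pow_succ] at this
    · calc t / m / 4 ^ k * m = t / 4 ^ k := by field_simp
        _ ≤ t := div_le_self ht.le (one_le_pow₀ (by norm_num))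

theorem Covers.fdist_le {L : E →L[ℝ] E} {N m k : ℕ} {r : ℝ} (h : Covers L N r) (hm : 0 < m)
    (hN : N < m ^ k) : fdist L ≤ 2 * m * 4 ^ k * r := by
  by_contra! hlt
  have hm' : (0 : ℝ) < m := by exact_mod_cast hm
  have hr : 0 ≤ r := (hmnc_nonneg L).trans h.hmnc_le
  obtain ⟨t, ht, ht'⟩ := exists_between hlt
  have ht0 : 0 < t := lt_of_le_of_lt (by positivity) ht
  refine absurd ((packs_of_lt_fdist ht0 hm k ht').le_of_covers h ?_) (not_le.2 hN)
  rw [div_div, lt_div_iff₀ (by positivity)]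
  linarith

end Covering

section MaximalErgodic

variable {X : Type*}

/-- The maximum of the Birkhoff sums of `f` of length at most `n`. -/
def maxBirkhoffSum (T : X → X) (f : X → ℝ) : ℕ → X → ℝ
  | 0 => fun _ => 0
  | n + 1 => fun x => max 0 (f x + maxBirkhoffSum T f n (T x))

theorem maxBirkhoffSum_nonneg (T : X → X) (f : X → ℝ) (n : ℕ) (x : X) :
    0 ≤ maxBirkhoffSum T f n x := by
  cases n with
  | zero => exact le_rfl
  | succ n => exact le_max_left _ _

theorem maxBirkhoffSum_le_succ (T : X → X) (f : X → ℝ) (n : ℕ) (x : X) :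
    maxBirkhoffSum T f n x ≤ maxBirkhoffSum T f (n + 1) x := by
  induction n generalizing x with
  | zero => exact maxBirkhoffSum_nonneg _ _ _ _
  | succ n ih => exact max_le_max le_rfl (add_le_add le_rfl (ih (T x)))

theorem birkhoffSum_le_maxBirkhoffSum (T : X → X) (f : X → ℝ) (n : ℕ) (x : X) :
    birkhoffSum T f n x ≤ maxBirkhoffSum T f n x := by
  induction n generalizing x with
  | zero => simp [maxBirkhoffSum]
  | succ n ih =>
    rw [birkhoffSum_succ']
    exact (add_le_add le_rfl (ih (T x))).trans (le_max_right _ _)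

variable [MeasurableSpace X] {μ : Measure X} {T : X → X}

theorem measurable_maxBirkhoffSum (hT : Measurable T) {f : X → ℝ} (hf : Measurable f) (n : ℕ) :
    Measurable (maxBirkhoffSum T f n) := by
  induction n with
  | zero => exact measurable_const
  | succ n ih => exact measurable_const.max (hf.add (ih.comp hT))

theorem integrable_maxBirkhoffSum (hT : MeasurePreserving T μ μ) {f : X → ℝ}
    (hf : Integrable f μ) (n : ℕ) : Integrable (maxBirkhoffSum T f n) μ := by
  induction n with
  | zero => exact integrable_zero _ _ _
  | succ n ih =>
    exact (integrable_zero _ _ _).sup (hf.add (hT.integrable_comp_of_integrable ih))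

/-- The maximal ergodic theorem. -/
theorem setIntegral_maxBirkhoffSum_pos_nonneg (hT : MeasurePreserving T μ μ) {f : X → ℝ}
    (hfm : Measurable f) (hf : Integrable f μ) (n : ℕ) :
    0 ≤ ∫ x in {x | 0 < maxBirkhoffSum T f n x}, f x ∂μ := by
  have hF := integrable_maxBirkhoffSum hT hf n
  have hFm := measurable_maxBirkhoffSum hT.measurable hfm n
  have hset : MeasurableSet {x | 0 < maxBirkhoffSum T f n x} :=
    measurableSet_lt measurable_const hFm
  have hFT : Integrable (fun x => maxBirkhoffSum T f n (T x)) μ :=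
    hT.integrable_comp_of_integrable hF
  have hzero : ∫ x, (maxBirkhoffSum T f n x - maxBirkhoffSum T f n (T x)) ∂μ = 0 := by
    rw [integral_sub hF hFT, sub_eq_zero]
    have h := integral_map (μ := μ) hT.measurable.aemeasurable (f := maxBirkhoffSum T f n)
      hFm.aestronglyMeasurable
    rwa [hT.map_eq] at h
  rw [← integral_indicator hset]
  refine hzero.ge.trans (integral_mono (hF.sub hFT) (hf.indicator hset) fun x => ?_)
  by_cases hx : 0 < maxBirkhoffSum T f n x
  · rw [Set.indicator_of_mem (show x ∈ {x | 0 < maxBirkhoffSum T f n x} from hx)]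
    have h1 := maxBirkhoffSum_le_succ T f n x
    have h2 : maxBirkhoffSum T f (n + 1) x = f x + maxBirkhoffSum T f n (T x) := by
      rcases max_choice 0 (f x + maxBirkhoffSum T f n (T x)) with h | h
      · exact absurd (h1.trans h.le) (not_le.2 hx)
      · exact h
    simp only
    linarith
  · rw [Set.indicator_of_notMem (show x ∉ {x | 0 < maxBirkhoffSum T f n x} from hx)]
    simp only
    linarith [maxBirkhoffSum_nonneg T f n (T x)]

/-- The maximal inequality for the frequency of visits to a measurable set. -/
theorem measure_exists_lt_birkhoffSum_indicator_le [IsProbabilityMeasure μ]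
    (hT : MeasurePreserving T μ μ) {B : Set X} (hB : MeasurableSet B) {s η : ℝ} (hs : 0 < s)
    (hη : μ.real B ≤ s * η) :
    μ {x | ∃ n : ℕ, s * n < birkhoffSum T (B.indicator fun _ => (1 : ℝ)) n x} ≤
      ENNReal.ofReal η := by
  set f : X → ℝ := fun x => B.indicator (fun _ => (1 : ℝ)) x - s with hf_def
  have hind : Measurable (B.indicator fun _ => (1 : ℝ)) := measurable_const.indicator hB
  have hindi : Integrable (B.indicator fun _ => (1 : ℝ)) μ :=
    (integrable_const _).indicator hB
  have hfm : Measurable f := hind.sub measurable_const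
  have hfi : Integrable f μ := hindi.sub (integrable_const _)
  have hmono : Monotone fun n => {x | 0 < maxBirkhoffSum T f n x} :=
    monotone_nat_of_le_succ fun n x hx => lt_of_lt_of_le hx (maxBirkhoffSum_le_succ T f n x)
  have hsub : {x | ∃ n : ℕ, s * n < birkhoffSum T (B.indicator fun _ => (1 : ℝ)) n x} ⊆
      ⋃ n, {x | 0 < maxBirkhoffSum T f n x} := by
    rintro x ⟨n, hn⟩
    refine Set.mem_iUnion.2 ⟨n, lt_of_lt_of_le ?_ (birkhoffSum_le_maxBirkhoffSum T f n x)⟩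
    have : birkhoffSum T f n x = birkhoffSum T (B.indicator fun _ => (1 : ℝ)) n x - s * n := by
      simp [birkhoffSum, hf_def, Finset.sum_sub_distrib, mul_comm]
    linarith
  refine (measure_mono hsub).trans ?_
  rw [hmono.measure_iUnion]
  refine iSup_le fun n => ?_
  have hset : MeasurableSet {x | 0 < maxBirkhoffSum T f n x} :=
    measurableSet_lt measurable_const (measurable_maxBirkhoffSum hT.measurable hfm n)
  rw [← ofReal_measureReal]
  refine ENNReal.ofReal_le_ofReal ?_
  have h := setIntegral_maxBirkhoffSum_pos_nonneg hT hfm hfi n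
  rw [integral_sub hindi.integrableOn (integrable_const _), setIntegral_indicator hB,
    setIntegral_const, setIntegral_const] at h
  have h2 : μ.real ({x | 0 < maxBirkhoffSum T f n x} ∩ B) ≤ μ.real B :=
    measureReal_mono Set.inter_subset_right
  simp only [smul_eq_mul, mul_one] at h
  refine le_of_mul_le_mul_left (a := s) ?_ hs
  linarith

/-- A measurable set containing its preimage under a measure-preserving map is almost surely
forward invariant. -/
theorem ae_forall_iterate_mem_of_preimage_subset [IsFiniteMeasure μ]
    (hT : MeasurePreserving T μ μ) {S : Set X} (hS : MeasurableSet S) (hsub : T ⁻¹' S ⊆ S) :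
    ∀ᵐ x ∂μ, x ∈ S → ∀ j, T^[j] x ∈ S := by
  have heq : (T ⁻¹' S : Set X) =ᵐ[μ] S :=
    ae_eq_of_subset_of_measure_ge hsub (hT.measure_preimage hS.nullMeasurableSet).ge
      (hT.measurable hS).nullMeasurableSet (measure_ne_top _ _)
  have hstep : ∀ᵐ x ∂μ, x ∈ S → T x ∈ S := by
    filter_upwards [heq.mem_iff] with x hx h using hx.2 h
  have hall : ∀ᵐ x ∂μ, ∀ j, T^[j] x ∈ S → T (T^[j] x) ∈ S :=
    ae_all_iff.2 fun j => (hT.iterate j).quasiMeasurePreserving.ae hstep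
  filter_upwards [hall] with x hx h j
  induction j with
  | zero => exact h
  | succ j ih => rw [Function.iterate_succ_apply']; exact hx j ih

end MaximalErgodic

section Cocycle

variable {E : Type*} [NormedAddCommGroup E] [NormedSpace ℝ E] {X : Type*}

/-- Covers of exponentially large cardinality do not affect the exponential rate at which their
radii control the distance to the finite-rank operators. -/
theorem eventually_fdist_lt_of_covers {L : ℕ → E →L[ℝ] E} {N : ℕ} {b b' c : ℝ} (hb : b < b')
    (h : ∀ n, Covers (L n) (N ^ n) (Real.exp (n * b + c))) :
    ∀ᶠ n : ℕ in atTop, fdist (L n) < Real.exp (n * b') := by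
  obtain ⟨ε, hε, rfl⟩ : ∃ ε > 0, b' = b + 2 * ε := ⟨(b' - b) / 2, by linarith, by ring⟩
  obtain ⟨k, hk0, hk⟩ : ∃ k : ℕ, k ≠ 0 ∧ (N : ℝ) ≤ Real.exp (ε * k) := by
    obtain ⟨k, hk⟩ := exists_nat_gt (N / ε)
    rw [div_lt_iff₀ hε] at hk
    refine ⟨k + 1, k.succ_ne_zero, ?_⟩
    have := Real.add_one_le_exp (ε * (k + 1))
    push_cast
    nlinarith
  have hlim : Tendsto (fun n : ℕ => ε * (n : ℝ)) atTop atTop :=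
    (tendsto_natCast_atTop_atTop).const_mul_atTop hε
  filter_upwards [(Real.tendsto_exp_atTop.comp hlim).eventually_gt_atTop
    (2 * 2 * 4 ^ k * Real.exp c)] with n hn
  simp only [Function.comp_apply] at hn
  set e := Real.exp (ε * n) with he
  have he1 : 1 ≤ e := Real.one_le_exp (by positivity)
  have hm : e < (⌊e⌋₊ + 1 : ℕ) := by exact_mod_cast Nat.lt_floor_add_one e
  have hm2 : ((⌊e⌋₊ + 1 : ℕ) : ℝ) ≤ 2 * e := by
    push_cast
    linarith [Nat.floor_le (zero_le_one.trans he1)]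
  have hN : N ^ n < (⌊e⌋₊ + 1) ^ k := by
    have : (N : ℝ) ^ n < ((⌊e⌋₊ + 1 : ℕ) : ℝ) ^ k := calc
      (N : ℝ) ^ n ≤ Real.exp (ε * k) ^ n := by gcongr
      _ = e ^ k := by rw [he, ← Real.exp_nat_mul, ← Real.exp_nat_mul]; congr 1; ring
      _ < _ := by gcongr
    exact_mod_cast this
  calc fdist (L n) ≤ 2 * (⌊e⌋₊ + 1 : ℕ) * 4 ^ k * Real.exp (n * b + c) :=
        (h n).fdist_le (Nat.succ_pos _) hN
    _ ≤ 2 * (2 * e) * 4 ^ k * Real.exp (n * b + c) := by gcongr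
    _ = (2 * 2 * 4 ^ k * Real.exp c) * (e * Real.exp (n * b)) := by rw [Real.exp_add]; ring
    _ < e * (e * Real.exp (n * b)) := by gcongr
    _ = Real.exp (n * (b + 2 * ε)) := by
        rw [he, ← Real.exp_add, ← Real.exp_add]; congr 1; ring

theorem exists_forall_covers_hmnc_add [TopologicalSpace X] [CompactSpace X] {A : X → E →L[ℝ] E}
    (hA : Continuous A) {δ : ℝ} (hδ : 0 < δ) : ∃ N, ∀ x, Covers (A x) N (hmnc (A x) + δ) := by
  suffices ∃ N, ∀ x ∈ (Set.univ : Set X), Covers (A x) N (hmnc (A x) + δ) by simpa using this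
  refine isCompact_univ.induction_on (p := fun s => ∃ N, ∀ x ∈ s, Covers (A x) N (hmnc (A x) + δ))
    ⟨0, by simp⟩ (fun s t hst ⟨N, hN⟩ => ⟨N, fun x hx => hN x (hst hx)⟩) ?_ ?_
  · rintro s t ⟨N, hN⟩ ⟨N', hN'⟩
    refine ⟨max N N', ?_⟩
    rintro x (hx | hx)
    · exact (hN x hx).mono (le_max_left _ _) le_rfl
    · exact (hN' x hx).mono (le_max_right _ _) le_rfl
  · intro x _
    obtain ⟨N, hN⟩ := exists_covers_of_hmnc_lt
      (lt_add_of_pos_right (hmnc (A x)) (by positivity : 0 < δ / 3))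
    have hnear : ∀ᶠ y in 𝓝 x, ‖A y - A x‖ < δ / 3 := by
      have h := Metric.tendsto_nhds.1 (hA.tendsto x) (δ / 3) (by positivity)
      simpa only [dist_eq_norm] using h
    refine ⟨_, mem_nhdsWithin_of_mem_nhds hnear, N, fun y hy => ?_⟩
    have hy' : ‖A y - A x‖ < δ / 3 := hy
    refine (hN.perturb hy'.le).mono le_rfl ?_
    have := hmnc_le_add_norm_sub (A y) (A x)
    rw [norm_sub_rev] at this
    linarith

variable {T : X → X} {𝒜 : X → ℕ → (E →L[ℝ] E)}

theorem norm_cocycle_le (hzero : ∀ x, 𝒜 x 0 = 1)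
    (hcoc : ∀ x n m, 𝒜 x (n + m) = 𝒜 (T^[m] x) n * 𝒜 x m) {C : ℝ}
    (hC : ∀ x, ‖𝒜 x 1‖ ≤ Real.exp C) (x : X) (n : ℕ) : ‖𝒜 x n‖ ≤ Real.exp (n * C) := by
  induction n generalizing x with
  | zero =>
    rw [hzero, Nat.cast_zero, zero_mul, Real.exp_zero]
    exact ContinuousLinearMap.norm_id_le
  | succ n ih =>
    rw [hcoc x n 1]
    calc _ ≤ ‖𝒜 (T^[1] x) n‖ * ‖𝒜 x 1‖ := norm_mul_le _ _
      _ ≤ Real.exp (n * C) * Real.exp C := by gcongr; exacts [ih _, hC x]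
      _ = _ := by rw [← Real.exp_add]; congr 1; push_cast; ring

/-- If outside of `B` the orbit of `x` can be cut into blocks of length at most `M` along which the
cocycle has good covers, then the cocycle has good covers up to the time spent in `B`. -/
theorem covers_of_tiling (hzero : ∀ x, 𝒜 x 0 = 1)
    (hcoc : ∀ x n m, 𝒜 x (n + m) = 𝒜 (T^[m] x) n * 𝒜 x m) {C : ℝ}
    (hC : ∀ x, ‖𝒜 x 1‖ ≤ Real.exp C) {B : Set X} {N M : ℕ} (hN : 1 ≤ N) {b : ℝ} (hb : b ≤ C)
    (n : ℕ) (x : X) (hx : ∀ j, T^[j] x ∉ B →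
      ∃ p, 1 ≤ p ∧ p ≤ M ∧ Covers (𝒜 (T^[j] x) p) N (Real.exp (p * b))) :
    Covers (𝒜 x n) (N ^ n) (Real.exp
      (n * b + (C - b) * (birkhoffSum T (B.indicator fun _ => (1 : ℝ)) n x + M))) := by
  set g : X → ℝ := B.indicator fun _ => (1 : ℝ) with hg
  have hg0 : ∀ y, 0 ≤ g y := fun y => Set.indicator_nonneg (fun _ _ => zero_le_one) y
  have hsum0 : ∀ k y, 0 ≤ birkhoffSum T g k y := fun k y => Finset.sum_nonneg fun i _ => hg0 _
  have hCb : 0 ≤ C - b := sub_nonneg.2 hb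
  induction n using Nat.strong_induction_on generalizing x with
  | _ n ih =>
  have tail : ∀ p, 1 ≤ p → p ≤ n → Covers (𝒜 (T^[p] x) (n - p)) (N ^ (n - p)) (Real.exp
      (((n - p : ℕ) : ℝ) * b + (C - b) * (birkhoffSum T g (n - p) (T^[p] x) + M))) := by
    intro p hp hpn
    refine ih (n - p) (by omega) _ fun j => ?_
    rw [← Function.iterate_add_apply]
    exact hx (j + p)
  have glue : ∀ p N' r, 1 ≤ p → p ≤ n → N' ≤ N → Covers (𝒜 x p) N' (Real.exp r) →
      r ≤ p * b + (C - b) * birkhoffSum T g p x → Covers (𝒜 x n) (N ^ n) (Real.exp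
      (n * b + (C - b) * (birkhoffSum T g n x + M))) := by
    intro p N' r hp hpn hN' hcov hr
    have h := (tail p hp hpn).mul hcov (Real.exp_pos _)
    rw [← hcoc, Nat.sub_add_cancel hpn, ← Real.exp_add] at h
    refine h.mono ?_ (Real.exp_le_exp.2 ?_)
    · calc N ^ (n - p) * N' ≤ N ^ (n - p) * N ^ 1 := by gcongr; simpa using hN'
        _ = N ^ (n - p + 1) := (pow_add _ _ _).symm
        _ ≤ N ^ n := Nat.pow_le_pow_right hN (by omega)
    · have hs : birkhoffSum T g n x = birkhoffSum T g p x + birkhoffSum T g (n - p) (T^[p] x) := by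
        rw [← birkhoffSum_add, Nat.add_sub_cancel' hpn]
      rw [hs, Nat.cast_sub hpn]
      linarith
  have trivial_cover : n ≤ M → Covers (𝒜 x n) (N ^ n) (Real.exp
      (n * b + (C - b) * (birkhoffSum T g n x + M))) := fun hnM => by
    refine (covers_one_of_norm_le (norm_cocycle_le hzero hcoc hC x n)).mono
      (Nat.one_le_pow _ _ hN) (Real.exp_le_exp.2 ?_)
    have h1 : (n : ℝ) ≤ birkhoffSum T g n x + M :=
      (Nat.cast_le.2 hnM).trans (le_add_of_nonneg_left (hsum0 n x))
    nlinarith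
  by_cases hn : n = 0
  · exact trivial_cover (by omega)
  by_cases hxB : x ∈ B
  · refine glue 1 1 C le_rfl (by omega) hN (covers_one_of_norm_le (hC x)) ?_
    rw [birkhoffSum_one, hg, Set.indicator_of_mem hxB]
    simp
  · obtain ⟨p, hp, hpM, hcov⟩ := hx 0 hxB
    by_cases hpn : p ≤ n
    · exact glue p N _ hp hpn le_rfl hcov
        (le_add_of_nonneg_right (mul_nonneg hCb (hsum0 p x)))
    · exact trivial_cover (by omega)

/-- Points where `‖𝒜(x,n)‖_χ` is infinitely often at most a constant times `exp (n * b)`. -/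
def slowSet (𝒜 : X → ℕ → (E →L[ℝ] E)) (b : ℝ) : Set X :=
  {x | ∃ K : ℕ, ∀ a : ℕ, ∃ n ≥ a, hmnc (𝒜 x n) < K * Real.exp (n * b)}

theorem preimage_slowSet_subset (hcoc : ∀ x n m, 𝒜 x (n + m) = 𝒜 (T^[m] x) n * 𝒜 x m) {C : ℝ}
    (hC : ∀ x, ‖𝒜 x 1‖ ≤ Real.exp C) (b : ℝ) : T ⁻¹' slowSet 𝒜 b ⊆ slowSet 𝒜 b := by
  rintro x ⟨K, hK⟩
  obtain ⟨K', hK'⟩ := exists_nat_ge (K * Real.exp (C - b))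
  refine ⟨K', fun a => ?_⟩
  obtain ⟨n, hn, hlt⟩ := hK a
  refine ⟨n + 1, by omega, ?_⟩
  rw [hcoc x n 1]
  calc hmnc (𝒜 (T^[1] x) n * 𝒜 x 1) ≤ hmnc (𝒜 (T x) n) * ‖𝒜 x 1‖ := hmnc_mul_le _ _
    _ ≤ hmnc (𝒜 (T x) n) * Real.exp C := by
        gcongr
        exacts [hmnc_nonneg _, hC x]
    _ < K * Real.exp (n * b) * Real.exp C := by gcongr
    _ = K * Real.exp (C - b) * Real.exp ((n + 1 : ℕ) * b) := by
        rw [mul_assoc, mul_assoc, ← Real.exp_add, ← Real.exp_add]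
        congr 2
        push_cast
        ring
    _ ≤ K' * Real.exp ((n + 1 : ℕ) * b) := by gcongr

theorem measurableSet_slowSet [TopologicalSpace X] [MeasurableSpace X] [BorelSpace X]
    (hcont : ∀ k, Continuous fun x => 𝒜 x k) (b : ℝ) : MeasurableSet (slowSet 𝒜 b) := by
  have : slowSet 𝒜 b = ⋃ K : ℕ, ⋂ a : ℕ, ⋃ n : ℕ, ⋃ _ : n ≥ a,
      {x | hmnc (𝒜 x n) < K * Real.exp (n * b)} := by
    ext x
    simp [slowSet]
  rw [this]
  refine MeasurableSet.iUnion fun K => MeasurableSet.iInter fun a => MeasurableSet.iUnion fun n =>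
    MeasurableSet.iUnion fun _ => measurableSet_lt ?_ measurable_const
  exact (continuous_hmnc.comp (hcont n)).measurable

theorem exists_hmnc_lt_of_mem_slowSet {b b' : ℝ} (hb : b < b') {x : X} (hx : x ∈ slowSet 𝒜 b) :
    ∃ p, 1 ≤ p ∧ hmnc (𝒜 x p) < Real.exp (p * b') := by
  obtain ⟨K, hK⟩ := hx
  have hlim : Tendsto (fun n : ℕ => (b' - b) * (n : ℝ)) atTop atTop :=
    (tendsto_natCast_atTop_atTop).const_mul_atTop (sub_pos.2 hb)
  obtain ⟨a, ha⟩ := eventually_atTop.1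
    ((Real.tendsto_exp_atTop.comp hlim).eventually_ge_atTop (K : ℝ))
  obtain ⟨n, hn, hlt⟩ := hK (a + 1)
  refine ⟨n, by omega, hlt.trans_le ?_⟩
  have := ha n (by omega)
  simp only [Function.comp_apply] at this
  calc K * Real.exp (n * b) ≤ Real.exp ((b' - b) * n) * Real.exp (n * b) := by gcongr
    _ = _ := by rw [← Real.exp_add]; congr 1; ring

theorem ae_eventually_fdist_lt [TopologicalSpace X] [CompactSpace X] [MeasurableSpace X]
    [BorelSpace X] {μ : Measure X} [IsProbabilityMeasure μ] (hT : MeasurePreserving T μ μ)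
    (hzero : ∀ x, 𝒜 x 0 = 1) (hcoc : ∀ x n m, 𝒜 x (n + m) = 𝒜 (T^[m] x) n * 𝒜 x m)
    (hcont : ∀ k, Continuous fun x => 𝒜 x k) {C : ℝ} (hC : ∀ x, ‖𝒜 x 1‖ ≤ Real.exp C)
    {b b' : ℝ} (hb : b < b') :
    ∀ᵐ x ∂μ, x ∈ slowSet 𝒜 b → ∀ᶠ n : ℕ in atTop, fdist (𝒜 x n) < Real.exp (n * b') := by
  obtain ⟨ε, hε, rfl⟩ : ∃ ε > 0, b' = b + 4 * ε := ⟨(b' - b) / 4, by linarith, by ring⟩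
  wlog hbC : b + 2 * ε ≤ C generalizing C
  · exact this (C := b + 2 * ε) (fun x => (hC x).trans (Real.exp_le_exp.2 (by linarith))) le_rfl
  set D := C - (b + 2 * ε) with hD
  have hD0 : 0 ≤ D := sub_nonneg.2 hbC
  obtain ⟨s, hs, hDs⟩ : ∃ s > 0, D * s ≤ ε := by
    refine ⟨ε / (D + 1), by positivity, ?_⟩
    rw [← mul_div_assoc, div_le_iff₀ (by positivity)]
    nlinarith
  have hinv := ae_forall_iterate_mem_of_preimage_subset hT (measurableSet_slowSet hcont b)
    (preimage_slowSet_subset hcoc hC b)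
  let B : ℕ → Set X := fun M =>
    slowSet 𝒜 b ∩ ⋂ p : ℕ, ⋂ _ : 1 ≤ p ∧ p ≤ M, {x | Real.exp (p * (b + ε)) ≤ hmnc (𝒜 x p)}
  have hBmem : ∀ {M x}, x ∈ slowSet 𝒜 b → x ∉ B M →
      ∃ p, 1 ≤ p ∧ p ≤ M ∧ hmnc (𝒜 x p) < Real.exp (p * (b + ε)) := by
    intro M x hx hxB
    by_contra! h
    exact hxB ⟨hx, by simpa using h⟩
  have hBmeas : ∀ M, MeasurableSet (B M) := fun M =>
    (measurableSet_slowSet hcont b).inter (MeasurableSet.iInter fun p => MeasurableSet.iInter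
      fun _ => measurableSet_le measurable_const (continuous_hmnc.comp (hcont p)).measurable)
  have hBanti : Antitone B := fun M M' hM x hx => by
    refine ⟨hx.1, ?_⟩
    have := hx.2
    simp only [Set.mem_iInter, Set.mem_ofPred_eq] at this ⊢
    exact fun p hp => this p ⟨hp.1, hp.2.trans hM⟩
  have hBinter : ⋂ M, B M = ∅ := by
    refine Set.eq_empty_of_forall_notMem fun x hx => ?_
    rw [Set.mem_iInter] at hx
    obtain ⟨p, hp, hlt⟩ := exists_hmnc_lt_of_mem_slowSet (by linarith : b < b + ε) (hx 0).1
    have := (hx p).2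
    simp only [Set.mem_iInter, Set.mem_ofPred_eq] at this
    exact absurd (this p ⟨hp, le_rfl⟩) (not_le.2 hlt)
  have hBlim : Tendsto (fun M => μ (B M)) atTop (𝓝 0) := by
    have := tendsto_measure_iInter_atTop (μ := μ) (fun M => (hBmeas M).nullMeasurableSet) hBanti
      ⟨0, measure_ne_top _ _⟩
    rwa [hBinter, measure_empty] at this
  rw [ae_iff]
  refine nonpos_iff_eq_zero.1 (le_of_forall_pos_le_add fun η' hη' => ?_)
  rw [zero_add]
  obtain ⟨η, hη, hηη'⟩ : ∃ η : ℝ, 0 < η ∧ ENNReal.ofReal η ≤ η' := by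
    rcases eq_or_ne η' ⊤ with rfl | hne
    · exact ⟨1, one_pos, le_top⟩
    · exact ⟨η'.toReal, ENNReal.toReal_pos hη'.ne' hne, (ENNReal.ofReal_toReal hne).le⟩
  refine le_trans ?_ hηη'
  obtain ⟨M, hM⟩ : ∃ M, μ.real (B M) ≤ s * η := by
    obtain ⟨M, hM⟩ := (hBlim.eventually_lt_const
      (ENNReal.ofReal_pos.2 (by positivity : 0 < s * η))).exists
    exact ⟨M, ENNReal.toReal_le_of_le_ofReal (by positivity) hM.le⟩
  have hNp : ∀ p : ℕ, ∃ N, 1 ≤ p → ∀ y, hmnc (𝒜 y p) < Real.exp (p * (b + ε)) →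
      Covers (𝒜 y p) N (Real.exp (p * (b + 2 * ε))) := fun p => by
    by_cases hp : 1 ≤ p
    · have hp' : (0 : ℝ) < p := by exact_mod_cast hp
      obtain ⟨N, hN⟩ := exists_forall_covers_hmnc_add (hcont p)
        (sub_pos.2 (Real.exp_lt_exp.2 (by nlinarith :
          (p : ℝ) * (b + ε) < p * (b + 2 * ε))))
      exact ⟨N, fun _ y hy => (hN y).mono le_rfl (by linarith)⟩
    · exact ⟨0, fun h => absurd h hp⟩
  choose Np hNp using hNp
  set N := 1 + ∑ p ∈ Finset.range (M + 1), Np p with hN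
  refine le_trans ?_ (measure_exists_lt_birkhoffSum_indicator_le hT (hBmeas M) hs hM)
  refine measure_mono_ae ?_
  filter_upwards [hinv] with x hx hbad
  by_contra hfreq
  refine hbad fun hslow => ?_
  have hfreq : ∀ n : ℕ, birkhoffSum T ((B M).indicator fun _ => (1 : ℝ)) n x ≤ s * n := by
    intro n
    by_contra! h
    exact hfreq ⟨n, h⟩
  refine eventually_fdist_lt_of_covers (N := N) (b := b + 3 * ε) (c := D * M) (by linarith)
    fun n => ?_
  refine (covers_of_tiling hzero hcoc hC (by omega) hbC n x (B := B M) (M := M) (N := N)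
    fun j hj => ?_).mono le_rfl (Real.exp_le_exp.2 ?_)
  · obtain ⟨p, hp, hpM, hlt⟩ := hBmem (hx hslow j) hj
    refine ⟨p, hp, hpM, (hNp p hp _ hlt).mono ?_ le_rfl⟩
    have := Finset.single_le_sum (f := Np) (fun _ _ => Nat.zero_le _)
      (Finset.mem_range.2 (by omega : p < M + 1))
    omega
  · have h1 := mul_le_mul_of_nonneg_left (hfreq n) hD0
    have h2 := mul_le_mul_of_nonneg_right hDs (Nat.cast_nonneg (α := ℝ) n)
    rw [← hD]
    linarith

end Cocycle

section Elog

theorem elog_mono {x y : ℝ} (hx : 0 ≤ x) (hxy : x ≤ y) : elog x ≤ elog y := by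
  rcases hx.eq_or_lt with rfl | hx
  · simp [elog]
  · simp only [elog, hx.ne', (hx.trans_le hxy).ne', if_false]
    exact_mod_cast Real.log_le_log hx hxy

theorem inv_mul_elog_lt_iff {n : ℕ} (hn : n ≠ 0) {x : ℝ} (hx : 0 ≤ x) (b : ℝ) :
    (((n : ℝ)⁻¹ : ℝ) : EReal) * elog x < b ↔ x < Real.exp (n * b) := by
  have hn' : (0 : ℝ) < n := by exact_mod_cast Nat.pos_of_ne_zero hn
  rcases hx.eq_or_lt with rfl | hx
  · simp only [elog, if_true, Real.exp_pos, iff_true]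
    rw [EReal.coe_mul_bot_of_pos (by positivity)]
    exact EReal.bot_lt_coe b
  · simp only [elog, hx.ne', if_false]
    rw [← EReal.coe_mul, EReal.coe_lt_coe_iff, inv_mul_lt_iff₀ hn', Real.log_lt_iff_lt_exp hx]

end Elog

/-- For a continuous injective linear cocycle `𝒜` over a homeomorphism `T` of a compact metric
space preserving a Borel probability measure `μ`, for `μ`-a.e. `x` the limits
`χ(x) = lim (1/n) log ‖𝒜(x,n)‖_χ` and `lim (1/n) log ‖𝒜(x,n)‖_f` exist in `ℝ ∪ {-∞}`
and coincide. -/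
theorem chi_rate_eq_f_rate {X : Type*} [MetricSpace X] [CompactSpace X]
    [MeasurableSpace X] [BorelSpace X] (T : X ≃ₜ X)
    (μ : Measure X) [IsProbabilityMeasure μ] (hT : MeasurePreserving T μ μ)
    (𝒜 : X → ℕ → (𝕏 →L[ℝ] 𝕏))
    (hcoc : ∀ x n m, 𝒜 x (n + m) = 𝒜 ((⇑T)^[m] x) n * 𝒜 x m)
    (hcont : ∀ k, Continuous fun x => 𝒜 x k)
    (hinj : ∀ x n, Function.Injective (𝒜 x n)) :
    ∀ᵐ x ∂μ, ∃ χ : EReal, χ ≠ ⊤ ∧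
      Tendsto (fun n : ℕ => (((n : ℝ)⁻¹ : ℝ) : EReal) * elog (hmnc (𝒜 x n)))
        atTop (nhds χ) ∧
      Tendsto (fun n : ℕ => (((n : ℝ)⁻¹ : ℝ) : EReal) * elog (fdist (𝒜 x n)))
        atTop (nhds χ) := by
  have hzero : ∀ x, 𝒜 x 0 = 1 := fun x => by
    ext v
    apply hinj x 0
    have := congrArg (fun L : 𝕏 →L[ℝ] 𝕏 => L v) (hcoc x 0 0)
    simpa using this.symm
  obtain ⟨C, hC⟩ : ∃ C, ∀ x, ‖𝒜 x 1‖ ≤ Real.exp C := by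
    obtain ⟨R, hR⟩ := (isCompact_range (hcont 1).norm).bddAbove
    exact ⟨R, fun x => (hR ⟨x, rfl⟩).trans (by linarith [Real.add_one_le_exp R])⟩
  have hae : ∀ᵐ x ∂μ, ∀ b b' : ℚ, b < b' → x ∈ slowSet 𝒜 b →
      ∀ᶠ n : ℕ in atTop, fdist (𝒜 x n) < Real.exp (n * b') := by
    refine ae_all_iff.2 fun b => ae_all_iff.2 fun b' => ?_
    by_cases hb : b < b'
    · filter_upwards [ae_eventually_fdist_lt hT hzero hcoc hcont hC (Rat.cast_lt.2 hb)] with x hx _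
        using hx
    · exact Eventually.of_forall fun x h => absurd h hb
  filter_upwards [hae] with x hx
  set u : ℕ → EReal := fun n => (((n : ℝ)⁻¹ : ℝ) : EReal) * elog (hmnc (𝒜 x n)) with hu
  set v : ℕ → EReal := fun n => (((n : ℝ)⁻¹ : ℝ) : EReal) * elog (fdist (𝒜 x n)) with hv
  have huv : ∀ n, u n ≤ v n := fun n => by
    refine mul_le_mul_of_nonneg_left (elog_mono (hmnc_nonneg _) (hmnc_le_fdist _)) ?_
    exact_mod_cast inv_nonneg.2 (Nat.cast_nonneg n)
  have hbound : ∀ᶠ n in atTop, u n < ((C + 1 : ℝ) : EReal) := by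
    filter_upwards [eventually_ne_atTop 0] with n hn
    refine (inv_mul_elog_lt_iff hn (hmnc_nonneg _) _).2 ?_
    refine ((hmnc_le_fdist _).trans ((fdist_le_norm _).trans
      (norm_cocycle_le hzero hcoc hC x n))).trans_lt (Real.exp_lt_exp.2 ?_)
    have : (0 : ℝ) < n := by exact_mod_cast Nat.pos_of_ne_zero hn
    linarith
  have hle : limsup v atTop ≤ liminf u atTop := by
    refine le_of_forall_gt_imp_ge_of_dense fun c hc => ?_
    obtain ⟨b', hb', hb'c⟩ := EReal.lt_iff_exists_rat_btwn.1 hc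
    obtain ⟨b, hb, hbb'⟩ := EReal.lt_iff_exists_rat_btwn.1 hb'
    have hbb' : b < b' := by exact_mod_cast hbb'
    have hslow : x ∈ slowSet 𝒜 b := by
      refine ⟨1, fun a => ?_⟩
      have hfreq : ∃ᶠ n in atTop, u n < ((b : ℝ) : EReal) :=
        frequently_lt_of_liminf_lt (by isBoundedDefault) hb
      obtain ⟨n, hn, hlt⟩ := frequently_atTop.1 hfreq (a + 1)
      refine ⟨n, by omega, ?_⟩
      rw [Nat.cast_one, one_mul]
      exact (inv_mul_elog_lt_iff (by omega) (hmnc_nonneg _) _).1 hlt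
    refine le_trans (limsup_le_of_le (by isBoundedDefault) ?_) hb'c.le
    filter_upwards [hx b b' hbb' hslow, eventually_ne_atTop 0] with n hlt hn
    exact ((inv_mul_elog_lt_iff hn (fdist_nonneg _) _).2 hlt).le
  have huv_liminf : liminf u atTop ≤ liminf v atTop := liminf_le_liminf (Eventually.of_forall huv)
  have huv_limsup : limsup u atTop ≤ limsup v atTop := limsup_le_limsup (Eventually.of_forall huv)
  refine ⟨liminf u atTop, ?_, ?_, ?_⟩
  · refine ne_top_of_le_ne_top (EReal.coe_ne_top (C + 1)) ?_
    exact (liminf_le_limsup).trans (limsup_le_of_le (by isBoundedDefault)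
      (hbound.mono fun n hn => hn.le))
  · exact tendsto_of_le_liminf_of_limsup_le le_rfl (huv_limsup.trans hle)
  · exact tendsto_of_le_liminf_of_limsup_le huv_liminf hle
end
end
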